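/- Fix d ≥ 2. There exist constants δ₂ > 0 and C₃, C > 0 depending only on the dimension d such that for every n ≥ 1 and every M ≥ b_n, with probability at least 1 − C exp(−n^{δ₂}) the subset uIDLA aggregate A_{⌊M n^{−1/2}⌋}(B[n]; M) contains the Euclidean ball B[n(1 + n^{−1/2} − C₃ n^{−3/4})^{1/d}]. In particular the probability bound does not depend on M. -/

import Mathlib

open MeasureTheory Filter
open scoped ENNReal

noncomputable section

/-- The `k`-th binary digit of `x ∈ [0,1)` (after the binary point). -/
def bit (x : ℝ) (k : ℕ) : Bool := ⌊x * 2 ^ (k + 1)⌋ % 2 == 1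

/-- From one uniform sample on `[0,1]`, extract countably many independent uniform
samples on `[0,1]`, using disjoint subsequences of binary digits. -/
def uSlice (x : ℝ) (i : ℕ) : ℝ :=
  ∑' j : ℕ, if bit x (Nat.pair i j) then ((2 : ℝ) ^ (-(j : ℤ) - 1)) else 0

/-- The base probability space: Lebesgue measure restricted to `[0,1]`. -/
def μ0 : Measure ℝ := volume.restrict (Set.Icc 0 1)

/-- The vertex set of the lattice `ℤ^d`. -/
abbrev V (d : ℕ) := Fin d → ℤ

instance (d : ℕ) : MeasurableSpace (Finset (V d)) := ⊤

open Classical in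
/-- `B[r]`: the Euclidean ball of radius `r` in `ℤ^d`, as a `Finset`. -/
def ball (d : ℕ) (r : ℝ) : Finset (V d) :=
  (Finset.Icc (fun _ => -⌈r⌉) (fun _ => ⌈r⌉)).filter
    (fun y => Real.sqrt (∑ i, ((y i : ℝ)) ^ 2) ≤ r)

/-- `b_n`: the number of lattice points in the Euclidean ball of radius `n`. -/
def bn (d n : ℕ) : ℕ := (ball d n).card

/-- The `2d` unit vectors of `ℤ^d` (the possible steps of the simple random walk). -/
def unitVecs (d : ℕ) : Finset (V d) :=
  Finset.image
    (fun p : Fin d × Bool => fun j => if j = p.1 then (if p.2 then 1 else -1) else 0)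
    Finset.univ

/-- Given `u` uniform on `[0,1]`, `pick S u` is a uniformly chosen element of `S`. -/
def pick {d : ℕ} (S : Finset (V d)) (u : ℝ) : V d :=
  if h : S.Nonempty then
    (S.equivFin.symm ⟨(⌊u * S.card⌋).toNat % S.card,
      Nat.mod_lt _ (Finset.card_pos.mpr h)⟩).val
  else 0

/-- Position at time `t` of the simple random walk started at `x`, driven by the
random seed `ω`: the steps `pick (unitVecs d) (uSlice ω i)` are i.i.d. uniform on
the `2d` unit vectors when `ω` is uniform on `[0,1]`. -/
def walk {d : ℕ} (x : V d) (ω : ℝ) (t : ℕ) : V d :=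
  x + ∑ i ∈ Finset.range t, pick (unitVecs d) (uSlice ω i)

/-- `t_S`: the first time the walk started at `x` is outside `S`. -/
def exitT {d : ℕ} (S : Finset (V d)) (x : V d) (ω : ℝ) : ℕ :=
  sInf {t | walk x ω t ∉ S}

/-- The position `ξ(t_S)` at which the walk started at `x` first exits `S`. -/
def hitPt {d : ℕ} (S : Finset (V d)) (x : V d) (ω : ℝ) : V d :=
  walk x ω (exitT S x ω)

/-- `Add[ξ,S]`: add to `S` the exit point of a random walk started at `x`. -/
def addPt {d : ℕ} (S : Finset (V d)) (x : V d) (ω : ℝ) : Finset (V d) :=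
  insert (hitPt S x ω) S

/-- `P_x(ξ(τ_A) = y)`: the probability that the walk started at `x` exits `A` at `y`. -/
def hitProb {d : ℕ} (A : Finset (V d)) (x y : V d) : ℝ≥0∞ :=
  μ0 {ω | hitPt A x ω = y}

/-- The outer boundary `∂A`: vertices outside `A` with a neighbour in `A`. -/
def outb {d : ℕ} (A : Finset (V d)) : Finset (V d) :=
  (A.biUnion fun x => (unitVecs d).image (fun e => x + e)) \ A

/-- `DA_X(S)`: the IDLA aggregate obtained from `S` by launching one particle from each
point of the list `xs` in turn (driven by independent slices of the seed `ω`). -/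
def daFrom {d : ℕ} : Finset (V d) → List (V d) → ℝ → Finset (V d)
  | S, [], _ => S
  | S, x :: xs, ω => daFrom (addPt S x (uSlice ω 0)) xs (uSlice ω 1)

/-- The law of the IDLA aggregate `DA_X(S)`. -/
def daLaw {d : ℕ} (S : Finset (V d)) (xs : List (V d)) : Measure (Finset (V d)) :=
  μ0.map (fun ω => daFrom S xs ω)

/-- One uIDLA step: launch a particle from a uniformly chosen point of `S`. -/
def uStep {d : ℕ} (S : Finset (V d)) (ω : ℝ) : Finset (V d) :=
  addPt S (pick S (uSlice ω 0)) (uSlice ω 1)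

/-- `A_k(S)`: the uIDLA aggregate obtained by adding `k` particles to `S`,
each started at a uniform point of the current aggregate. -/
def uAggFrom {d : ℕ} (S : Finset (V d)) (ω : ℝ) : ℕ → Finset (V d)
  | 0 => S
  | k + 1 => uStep (uAggFrom S ω k) (uSlice ω k)

/-- The law of the uIDLA aggregate `A_k(S)`. -/
def uLaw {d : ℕ} (S : Finset (V d)) (k : ℕ) : Measure (Finset (V d)) :=
  μ0.map (fun ω => uAggFrom S ω k)

/-- One step of the subset uIDLA `A_·(E;m)`: at step `k`, perform a uIDLA step
with probability `|E|/(m+k)` and otherwise do nothing. -/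
def subStep {d : ℕ} (m k : ℕ) (E : Finset (V d)) (ω : ℝ) : Finset (V d) :=
  if uSlice ω 0 * ((m : ℝ) + k) ≤ E.card then uStep E (uSlice ω 1) else E

/-- The subset uIDLA `A_n(E;m)`. -/
def subAggFrom {d : ℕ} (E : Finset (V d)) (m : ℕ) (ω : ℝ) : ℕ → Finset (V d)
  | 0 => E
  | k + 1 => subStep m k (subAggFrom E m ω k) (uSlice ω k)

/-- The law of the subset uIDLA `A_n(E;m)`. -/
def subLaw {d : ℕ} (E : Finset (V d)) (m k : ℕ) : Measure (Finset (V d)) :=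
  μ0.map (fun ω => subAggFrom E m ω k)

/-- Stochastic domination of random finite subsets of `ℤ^d`: `μ` dominates `ν` if
there is a coupling under which the sample of `ν` is a.s. contained in that of `μ`. -/
def StochDom {d : ℕ} (μ ν : Measure (Finset (V d))) : Prop :=
  ∃ π : Measure (Finset (V d) × Finset (V d)), IsProbabilityMeasure π ∧
    π.map Prod.fst = μ ∧ π.map Prod.snd = ν ∧ π {p | p.2 ⊆ p.1} = 1

/-- A `Geometric(1/2)` sample (taking value `j ≥ 0` with probability `2^{-(j+1)}`)
produced from a uniform sample `u` on `[0,1]` by inverting the CDF. -/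
def geom (u : ℝ) : ℕ := sInf {j : ℕ | u ≤ 1 - (2 : ℝ) ^ (-(j : ℤ) - 1)}

/-- The parent of vertex `j ≥ 1` in the uniform random recursive tree (vertex `0` is
the root): uniform on `{0, …, j-1}` when the seed is uniform on `[0,1]`. -/
def parent (ω : ℝ) (j : ℕ) : ℕ := (⌊uSlice ω (Nat.pair 0 j) * j⌋).toNat % j

/-- The reaching time of vertex `j` in a uniform random recursive tree whose edges
carry i.i.d. `Geometric(1/2)` weights: the sum of the weights on the path from the
root to `j`. (The `min` is a.s. inoperative, since a.s. `parent ω (j+1) ≤ j`.) -/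
def reach (ω : ℝ) : ℕ → ℕ
  | 0 => 0
  | j + 1 => reach ω (min (parent ω (j + 1)) j) + geom (uSlice ω (Nat.pair 1 (j + 1)))
termination_by j => j
decreasing_by exact Nat.lt_succ_of_le (min_le_right _ _)

end

/-! ### Part 1: slices of a uniform variable are i.i.d. uniform -/

lemma mu0_eq : μ0 = volume.restrict (Set.Ico 0 1) := by
  unfold μ0
  exact (Measure.restrict_congr_set Ico_ae_eq_Icc).symm

instance mu0_prob : IsProbabilityMeasure μ0 := by
  constructor
  unfold μ0
  simp

lemma measurable_bit (k : ℕ) : Measurable (fun x : ℝ => bit x k) := by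
  unfold bit
  have h1 : Measurable (fun x : ℝ => ⌊x * 2 ^ (k + 1)⌋) := by fun_prop
  exact (measurable_from_top (f := fun m : ℤ => (m % 2 == 1))).comp h1

lemma bit_zero_of_lt {x : ℝ} (h0 : 0 ≤ x) (h1 : x < 1) :
    (bit x 0 = false ↔ x < 1 / 2) := by
  unfold bit
  by_cases h : x < 1 / 2
  · have : ⌊x * 2 ^ (0 + 1)⌋ = 0 := by
      rw [Int.floor_eq_iff]; push_cast; constructor <;> norm_num <;> linarith
    rw [this]; simpa using h
  · have : ⌊x * 2 ^ (0 + 1)⌋ = 1 := by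
      rw [Int.floor_eq_iff]; push_cast; constructor <;> norm_num <;> linarith
    rw [this]; simpa using h

lemma fract_two_mul {x : ℝ} (h0 : 0 ≤ x) (h1 : x < 1) :
    Int.fract (2 * x) = if x < 1 / 2 then 2 * x else 2 * x - 1 := by
  split_ifs with h
  · rw [Int.fract_eq_self]; constructor <;> linarith
  · rw [Int.fract_eq_iff]
    refine ⟨by linarith, by linarith, 1, by push_cast; ring⟩

lemma volume_affine (c : ℝ) (B : Set ℝ) :
    volume ((fun x : ℝ => 2 * x - c) ⁻¹' B) = 2⁻¹ * volume B := by
  have : (fun x : ℝ => 2 * x - c) ⁻¹' B = (fun x : ℝ => 2 * x) ⁻¹' ((fun y => y - c) ⁻¹' B) := rfl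
  rw [this, Real.volume_preimage_mul_left (by norm_num)]
  have h2 : volume ((fun y : ℝ => y - c) ⁻¹' B) = volume B := by
    simp_rw [sub_eq_add_neg]
    exact measure_preimage_add_right _ _ _
  rw [h2]
  congr 1
  rw [abs_of_pos (by norm_num), ENNReal.ofReal_inv_of_pos (by norm_num)]
  norm_num

lemma dbl_b (b : Bool) (A : Set ℝ) (hA : MeasurableSet A) :
    μ0 {x | bit x 0 = b ∧ Int.fract (2 * x) ∈ A} = 2⁻¹ * μ0 A := by
  rw [mu0_eq, Measure.restrict_apply' measurableSet_Ico, Measure.restrict_apply' measurableSet_Ico]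
  rw [← volume_affine (if b then 1 else 0)]
  congr 1
  ext x
  simp only [Set.mem_inter_iff, Set.mem_ofPred_eq, Set.mem_Ico, Set.mem_preimage]
  constructor
  · rintro ⟨⟨hb, hx⟩, h0, h1⟩
    have e1 := bit_zero_of_lt h0 h1
    have e2 := fract_two_mul h0 h1
    cases b
    · have hlt := e1.1 hb
      rw [if_pos hlt] at e2
      rw [e2] at hx
      simp
      exact ⟨hx, by linarith, by linarith⟩
    · have hlt : ¬ x < 1 / 2 := by rw [← e1, hb]; simp
      rw [if_neg hlt] at e2
      rw [e2] at hx
      simp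
      exact ⟨hx, by linarith, by linarith⟩
  · cases b
    · simp
      rintro hx h0 h1
      have h0' : 0 ≤ x := by linarith
      have h1' : x < 1 := by linarith
      have e1 := bit_zero_of_lt h0' h1'
      have e2 := fract_two_mul h0' h1'
      rw [if_pos (by linarith)] at e2
      rw [e2]
      exact ⟨⟨e1.2 (by linarith), hx⟩, h0', h1'⟩
    · simp
      rintro hx h0 h1
      have h0' : 0 ≤ x := by linarith
      have h1' : x < 1 := by linarith
      have e1 := bit_zero_of_lt h0' h1'
      have e2 := fract_two_mul h0' h1'
      rw [if_neg (by linarith)] at e2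
      rw [e2]
      refine ⟨⟨?_, hx⟩, h0', h1'⟩
      by_contra hc
      have := e1.1 (by simpa using hc)
      linarith

/-- The law of a fair coin. -/
noncomputable def coin : Measure Bool := (2⁻¹ : ℝ≥0∞) • Measure.dirac false + (2⁻¹ : ℝ≥0∞) • Measure.dirac true

instance coin_prob : IsProbabilityMeasure coin := by
  constructor
  simp [coin, ENNReal.inv_two_add_inv_two]

lemma dbl (t : Set Bool) (A : Set ℝ) (hA : MeasurableSet A) :
    μ0 {x | bit x 0 ∈ t ∧ Int.fract (2 * x) ∈ A} = coin t * μ0 A := by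
  have hm : ∀ b : Bool, MeasurableSet {x : ℝ | bit x 0 = b ∧ Int.fract (2 * x) ∈ A} := by
    intro b
    apply MeasurableSet.inter
    · exact measurable_bit 0 (measurableSet_singleton b)
    · exact (by fun_prop : Measurable (fun x : ℝ => Int.fract (2 * x))) hA
  have hsplit : {x | bit x 0 ∈ t ∧ Int.fract (2 * x) ∈ A} =
      {x | (bit x 0 = false ∧ Int.fract (2 * x) ∈ A) ∧ false ∈ t} ∪
      {x | (bit x 0 = true ∧ Int.fract (2 * x) ∈ A) ∧ true ∈ t} := by
    ext x
    simp only [Set.mem_ofPred_eq, Set.mem_union]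
    cases bit x 0 <;> simp <;> tauto
  rw [hsplit, measure_union]
  · by_cases hf : false ∈ t <;> by_cases ht : true ∈ t <;>
      simp [hf, ht, coin, dbl_b _ _ hA, add_mul]
  · rw [Set.disjoint_left]
    rintro x ⟨⟨h1, _⟩, _⟩ ⟨⟨h2, _⟩, _⟩
    rw [h1] at h2; simp at h2
  · by_cases ht : true ∈ t <;> simp [ht, hm]

lemma bit_succ (x : ℝ) (k : ℕ) : bit x (k + 1) = bit (Int.fract (2 * x)) k := by
  unfold bit
  have : ⌊Int.fract (2 * x) * 2 ^ (k + 1)⌋ = ⌊x * 2 ^ (k + 1 + 1)⌋ - ⌊2 * x⌋ * 2 ^ (k + 1) := by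
    rw [← Int.floor_sub_intCast]
    congr 1
    unfold Int.fract
    push_cast
    ring
  rw [this]
  have h2 : (⌊x * 2 ^ (k + 1 + 1)⌋ - ⌊2 * x⌋ * 2 ^ (k + 1)) % 2 = ⌊x * 2 ^ (k + 1 + 1)⌋ % 2 := by
    have : ⌊2 * x⌋ * 2 ^ (k + 1) = 2 * (⌊2 * x⌋ * 2 ^ k) := by ring
    rw [this]
    omega
  rw [h2]

lemma bits_box (k : ℕ) : ∀ t : ℕ → Set Bool,
    μ0 {x | ∀ i < k, bit x i ∈ t i} = ∏ i ∈ Finset.range k, coin (t i) := by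
  induction k with
  | zero => intro t; simp
  | succ k ih =>
    intro t
    have : {x | ∀ i < k + 1, bit x i ∈ t i} =
        {x | bit x 0 ∈ t 0 ∧ Int.fract (2 * x) ∈ {y | ∀ i < k, bit y i ∈ t (i + 1)}} := by
      ext x
      simp only [Set.mem_ofPred_eq, Nat.forall_lt_succ_left, bit_succ]
    rw [this, dbl, ih (fun i => t (i + 1)), Finset.prod_range_succ', mul_comm]
    have : {y : ℝ | ∀ i < k, bit y i ∈ t (i + 1)} = ⋂ i ∈ Finset.range k, (fun y => bit y i) ⁻¹' (t (i + 1)) := by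
      ext; simp
    rw [this]
    exact Finset.measurableSet_biInter _ fun i _ => measurable_bit i (MeasurableSet.of_discrete)

lemma bits_law : μ0.map (fun x k => bit x k) = Measure.infinitePi (fun _ : ℕ => coin) := by
  have hm : Measurable (fun (x : ℝ) (k : ℕ) => bit x k) := measurable_pi_iff.2 measurable_bit
  apply Measure.eq_infinitePi
  intro s t ht
  classical
  rw [Measure.map_apply hm (.pi s.countable_toSet fun _ _ => ht _)]
  obtain ⟨k, hk⟩ : ∃ k, s ⊆ Finset.range k := ⟨s.sup id + 1, fun i hi => by
    simpa [Nat.lt_succ_iff] using Finset.le_sup (f := id) hi⟩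
  have := bits_box k (fun i => if i ∈ s then t i else Set.univ)
  have h2 : (fun (x : ℝ) (k : ℕ) => bit x k) ⁻¹' (Set.pi s t) =
      {x | ∀ i < k, bit x i ∈ (fun i => if i ∈ s then t i else Set.univ) i} := by
    ext x
    simp only [Set.mem_preimage, Set.mem_pi, Finset.mem_coe, Set.mem_ofPred_eq]
    constructor
    · intro h i _
      by_cases hi : i ∈ s
      · simpa [hi] using h i hi
      · simp [hi]
    · intro h i hi
      simpa [hi] using h i (Finset.mem_range.1 (hk hi))
  rw [h2, this]
  rw [← Finset.prod_subset hk]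
  · exact Finset.prod_congr rfl fun i hi => by simp [hi]
  · intro i _ hi
    rw [if_neg hi]
    exact measure_univ

/-- The number with given binary digits. -/
noncomputable def bsum (b : ℕ → Bool) : ℝ := ∑' j : ℕ, if b j then ((2 : ℝ) ^ (-(j : ℤ) - 1)) else 0

lemma measurable_bsum : Measurable bsum := by
  unfold bsum
  refine Measurable.tsum fun j => ?_
  exact (measurable_from_top (f := fun c : Bool => if c then ((2 : ℝ) ^ (-(j : ℤ) - 1)) else 0)).comp
    (measurable_pi_apply j)

lemma uSlice_eq (x : ℝ) (i : ℕ) : uSlice x i = bsum (fun j => bit x (Nat.pair i j)) := rfl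

lemma bsum_partial {x : ℝ} (h0 : 0 ≤ x) (h1 : x < 1) (k : ℕ) :
    ∑ j ∈ Finset.range k, (if bit x j then ((2 : ℝ) ^ (-(j : ℤ) - 1)) else 0) = ⌊x * 2 ^ k⌋ / 2 ^ k := by
  induction k with
  | zero =>
    have : ⌊x⌋ = 0 := by rw [Int.floor_eq_iff]; push_cast; constructor <;> linarith
    simp [this]
  | succ k ih =>
    rw [Finset.sum_range_succ, ih]
    have hp : (2 : ℝ) ^ (-(k : ℤ) - 1) = 1 / 2 ^ (k + 1) := by
      rw [show (-(k : ℤ) - 1) = -((k + 1 : ℕ) : ℤ) by push_cast; ring, zpow_neg, zpow_natCast]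
      simp
    have hk : ⌊x * 2 ^ (k + 1)⌋ = 2 * ⌊x * 2 ^ k⌋ + (if bit x k then 1 else 0) := by
      have a1 := Int.floor_le (x * 2 ^ k)
      have a2 := Int.lt_floor_add_one (x * 2 ^ k)
      have hor : ⌊x * 2 ^ (k + 1)⌋ = 2 * ⌊x * 2 ^ k⌋ ∨ ⌊x * 2 ^ (k + 1)⌋ = 2 * ⌊x * 2 ^ k⌋ + 1 := by
        have b1 : 2 * ⌊x * 2 ^ k⌋ ≤ ⌊x * 2 ^ (k + 1)⌋ := by
          rw [Int.le_floor]; push_cast; rw [pow_succ]; linarith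
        have b2 : ⌊x * 2 ^ (k + 1)⌋ < 2 * ⌊x * 2 ^ k⌋ + 2 := by
          rw [Int.floor_lt]; push_cast; rw [pow_succ]; linarith
        omega
      unfold bit
      rcases hor with h | h
      · rw [h]; simp
      · rw [h]
        have : (2 * ⌊x * 2 ^ k⌋ + 1) % 2 = 1 := by omega
        simp [this]
    rw [hk, hp, pow_succ]
    split_ifs <;> push_cast <;> field_simp <;> ring

lemma bsum_bits {x : ℝ} (h0 : 0 ≤ x) (h1 : x < 1) : bsum (fun k => bit x k) = x := by
  unfold bsum
  apply HasSum.tsum_eq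
  rw [hasSum_iff_tendsto_nat_of_nonneg]
  · simp_rw [bsum_partial h0 h1]
    have hlim : Tendsto (fun k : ℕ => x - (1 / 2 : ℝ) ^ k) atTop (nhds x) := by
      have := (tendsto_pow_atTop_nhds_zero_of_lt_one (r := (1 / 2 : ℝ)) (by norm_num) (by norm_num)).const_sub x
      simpa using this
    refine tendsto_of_tendsto_of_tendsto_of_le_of_le hlim tendsto_const_nhds ?_ ?_
    · intro k
      have a2 := Int.lt_floor_add_one (x * 2 ^ k)
      have hp : (0 : ℝ) < 2 ^ k := by positivity
      simp only
      rw [one_div, inv_pow, le_div_iff₀ hp, sub_mul, inv_mul_cancel₀ hp.ne']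
      linarith
    · intro k
      have a1 := Int.floor_le (x * 2 ^ k)
      have hp : (0 : ℝ) < 2 ^ k := by positivity
      simp only
      rwa [div_le_iff₀ hp]
  · intro i; split_ifs <;> positivity

lemma bsum_law : (Measure.infinitePi (fun _ : ℕ => coin)).map bsum = μ0 := by
  have hm : Measurable (fun (x : ℝ) (k : ℕ) => bit x k) := measurable_pi_iff.2 measurable_bit
  rw [← bits_law, Measure.map_map measurable_bsum hm]
  have : bsum ∘ (fun (x : ℝ) (k : ℕ) => bit x k) =ᵐ[μ0] id := by
    rw [mu0_eq]
    filter_upwards [ae_restrict_mem measurableSet_Ico] with x hx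
    exact bsum_bits hx.1 hx.2
  rw [Measure.map_congr this, Measure.map_id]

lemma uSlice_law_all : μ0.map (fun x i => uSlice x i) = Measure.infinitePi (fun _ : ℕ => μ0) := by
  have hm : Measurable (fun (x : ℝ) (k : ℕ) => bit x k) := measurable_pi_iff.2 measurable_bit
  have e1 := Measure.map_infinitePi_infinitePi_of_inj (P := fun _ : ℕ => coin)
    (f := fun p : ℕ × ℕ => Nat.pair p.1 p.2) (fun p q h => by
      have := Nat.pair_eq_pair.1 h
      exact Prod.ext this.1 this.2)
  have e2 := Measure.infinitePi_map_curry (fun _ _ : ℕ => coin)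
  have e3 := Measure.infinitePi_map_pi (fun _ : ℕ => Measure.infinitePi (fun _ : ℕ => coin))
    (f := fun _ => bsum) (fun _ => measurable_bsum)
  simp only [bsum_law] at e3
  rw [← e3, ← e2, ← e1, ← bits_law, Measure.map_map _ hm, Measure.map_map _ (by fun_prop),
    Measure.map_map _ (by fun_prop)]
  · rfl
  · refine measurable_pi_iff.2 fun i => measurable_bsum.comp ?_
    exact (measurable_pi_apply i).comp (MeasurableEquiv.curry ℕ ℕ Bool).measurable
  · refine measurable_pi_iff.2 fun i => measurable_bsum.comp (measurable_pi_apply i)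
  · exact measurable_pi_iff.2 fun p => measurable_pi_apply _

lemma measurable_uSlice (i : ℕ) : Measurable (fun x => uSlice x i) := by
  simp_rw [uSlice_eq]
  exact measurable_bsum.comp (measurable_pi_iff.2 fun j => measurable_bit _)

lemma uSlice_law (i : ℕ) : μ0.map (fun x => uSlice x i) = μ0 := by
  have h := Measure.infinitePi_map_eval (fun _ : ℕ => μ0) i
  rw [← uSlice_law_all, Measure.map_map (by fun_prop) (measurable_pi_iff.2 measurable_uSlice)] at h
  exact h

lemma uSlice_indep : ProbabilityTheory.iIndepFun (fun i x => uSlice x i) μ0 := by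
  rw [ProbabilityTheory.iIndepFun_iff_map_fun_eq_infinitePi_map measurable_uSlice]
  simp only [uSlice_law]
  exact uSlice_law_all

/-! ### Part 2: Markov chains driven by slices -/

/-- A chain driven by the successive slices of the seed. -/
noncomputable def chain {α : Type} (step : ℕ → α → ℝ → α) (a0 : α) (ω : ℝ) : ℕ → α
  | 0 => a0
  | k + 1 => step k (chain step a0 ω k) (uSlice ω k)

section Chain

variable {α : Type} [Countable α] [MeasurableSpace α] [DiscreteMeasurableSpace α]

lemma chain_factor (step : ℕ → α → ℝ → α) (hstep : ∀ k a, Measurable (step k a)) (a0 : α) (k : ℕ) :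
    ∃ G : ((i : Finset.range k) → ℝ) → α, Measurable G ∧
      ∀ ω, chain step a0 ω k = G (fun i => uSlice ω i) := by
  induction k with
  | zero => exact ⟨fun _ => a0, measurable_const, fun ω => rfl⟩
  | succ k ih =>
    obtain ⟨G, hG, hGe⟩ := ih
    have hF : Measurable (fun p : α × ℝ => step k p.1 p.2) :=
      measurable_from_prod_countable_right (fun a => hstep k a)
    refine ⟨fun v => step k (G (fun i => v ⟨i.1, by
      have := Finset.mem_range.1 i.2; exact Finset.mem_range.2 (by omega)⟩)) (v ⟨k, by simp⟩), ?_, ?_⟩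
    · refine hF.comp (Measurable.prodMk (hG.comp ?_) (measurable_pi_apply _))
      exact measurable_pi_iff.2 fun i => measurable_pi_apply _
    · intro ω
      simp only [chain, hGe]

lemma measurable_chain (step : ℕ → α → ℝ → α) (hstep : ∀ k a, Measurable (step k a)) (a0 : α) (k : ℕ) :
    Measurable (fun ω => chain step a0 ω k) := by
  obtain ⟨G, hG, hGe⟩ := chain_factor step hstep a0 k
  simp_rw [hGe]
  exact hG.comp (measurable_pi_iff.2 fun i => measurable_uSlice i)

lemma chain_step (step : ℕ → α → ℝ → α) (hstep : ∀ k a, Measurable (step k a)) (a0 : α) (k : ℕ)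
    (f : α → ℝ≥0∞) :
    ∫⁻ ω, f (chain step a0 ω (k + 1)) ∂μ0 =
      ∫⁻ ω, ∫⁻ u, f (step k (chain step a0 ω k) u) ∂μ0 ∂μ0 := by
  have hc := measurable_chain step hstep a0 k
  have hind : ProbabilityTheory.IndepFun (fun ω => chain step a0 ω k) (fun ω => uSlice ω k) μ0 := by
    obtain ⟨G, hG, hGe⟩ := chain_factor step hstep a0 k
    have h := uSlice_indep.indepFun_finset (Finset.range k) {k} (by simp) measurable_uSlice
    have h2 := h.comp hG (measurable_pi_apply (⟨k, by simp⟩ : ({k} : Finset ℕ)))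
    have e1 : (fun ω => chain step a0 ω k) = G ∘ (fun a (i : Finset.range k) => uSlice a i) := by
      funext ω; exact hGe ω
    rw [e1]
    exact h2
  have hF : Measurable (fun p : α × ℝ => f (step k p.1 p.2)) :=
    measurable_from_prod_countable_right (fun a => (measurable_of_countable f).comp (hstep k a))
  have hmap := (ProbabilityTheory.indepFun_iff_map_prod_eq_prod_map_map hc.aemeasurable
    (measurable_uSlice k).aemeasurable).1 hind
  rw [uSlice_law] at hmap
  calc ∫⁻ ω, f (chain step a0 ω (k + 1)) ∂μ0
      = ∫⁻ ω, (fun p : α × ℝ => f (step k p.1 p.2)) (chain step a0 ω k, uSlice ω k) ∂μ0 := rfl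
    _ = ∫⁻ p, f (step k p.1 p.2) ∂(μ0.map (fun ω => (chain step a0 ω k, uSlice ω k))) := by
        rw [lintegral_map hF (hc.prodMk (measurable_uSlice k))]
    _ = ∫⁻ a, ∫⁻ u, f (step k a u) ∂μ0 ∂(μ0.map (fun ω => chain step a0 ω k)) := by
        rw [hmap, lintegral_prod _ hF.aemeasurable]
    _ = _ := by
        rw [lintegral_map (measurable_of_countable _) hc]

lemma chain_super (step : ℕ → α → ℝ → α) (hstep : ∀ k a, Measurable (step k a)) (a0 : α)
    (N : ℕ) (I : ℕ → α → Prop) (Φ : ℕ → α → ℝ≥0∞) (hI0 : I 0 a0)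
    (hI : ∀ k a u, I k a → I (k + 1) (step k a u))
    (hΦ : ∀ k < N, ∀ a, I k a → ∫⁻ u, Φ (k + 1) (step k a u) ∂μ0 ≤ Φ k a) :
    ∫⁻ ω, Φ N (chain step a0 ω N) ∂μ0 ≤ Φ 0 a0 := by
  have hIc : ∀ k ω, I k (chain step a0 ω k) := by
    intro k ω
    induction k with
    | zero => exact hI0
    | succ k ih => exact hI _ _ _ ih
  induction N with
  | zero => simp [chain]
  | succ N ih =>
    rw [chain_step step hstep]
    refine le_trans (lintegral_mono fun ω => ?_) (ih fun k hk => hΦ k (by omega))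
    exact hΦ N (by omega) _ (hIc _ _)

end Chain

/-! ### Part 3: uniform picks and stopped walks -/

lemma mu0_cell (c j : ℕ) (hc : 0 < c) (hj : j < c) :
    μ0 {u | (⌊u * c⌋).toNat % c = j} = (c : ℝ≥0∞)⁻¹ := by
  have hc' : (0 : ℝ) < c := by exact_mod_cast hc
  rw [mu0_eq, Measure.restrict_apply' measurableSet_Ico]
  have : {u : ℝ | (⌊u * c⌋).toNat % c = j} ∩ Set.Ico 0 1 = Set.Ico ((j : ℝ) / c) ((j + 1) / c) := by
    ext u
    simp only [Set.mem_inter_iff, Set.mem_ofPred_eq, Set.mem_Ico]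
    rw [div_le_iff₀ hc', lt_div_iff₀ hc']
    constructor
    · rintro ⟨h, h0, h1⟩
      have hf0 : 0 ≤ ⌊u * c⌋ := Int.floor_nonneg.2 (by positivity)
      have hf1 : ⌊u * c⌋ < c := by
        rw [Int.floor_lt]; push_cast; nlinarith
      have hlt : (⌊u * c⌋).toNat < c := by omega
      rw [Nat.mod_eq_of_lt hlt] at h
      have hfe : ⌊u * c⌋ = j := by omega
      rw [Int.floor_eq_iff] at hfe
      exact_mod_cast hfe
    · rintro ⟨h0, h1⟩
      have hfe : ⌊u * c⌋ = j := by
        rw [Int.floor_eq_iff]; push_cast; exact ⟨h0, h1⟩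
      refine ⟨by rw [hfe]; simp [Nat.mod_eq_of_lt hj], ?_, ?_⟩
      · by_contra hneg
        push Not at hneg
        have : u * c < 0 := mul_neg_of_neg_of_pos hneg hc'
        have : (0 : ℝ) ≤ j := by positivity
        linarith
      · have : (j : ℝ) + 1 ≤ c := by exact_mod_cast hj
        by_contra hge
        push Not at hge
        nlinarith
  rw [this, Real.volume_Ico]
  have : ((j : ℝ) + 1) / c - j / c = (c : ℝ)⁻¹ := by field_simp; ring
  rw [this, ENNReal.ofReal_inv_of_pos hc', ENNReal.ofReal_natCast]

/-- index used by `pick` -/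
noncomputable def pidx (c : ℕ) (hc : 0 < c) (u : ℝ) : Fin c := ⟨(⌊u * c⌋).toNat % c, Nat.mod_lt _ hc⟩

lemma measurable_pidx (c : ℕ) (hc : 0 < c) : Measurable (pidx c hc) := by
  have h1 : Measurable (fun u : ℝ => ⌊u * c⌋) := by fun_prop
  exact (measurable_from_top (f := fun m : ℤ => (⟨m.toNat % c, Nat.mod_lt _ hc⟩ : Fin c))).comp h1

lemma pick_eq {d : ℕ} (S : Finset (V d)) (h : S.Nonempty) (u : ℝ) :
    pick S u = (S.equivFin.symm (pidx S.card (Finset.card_pos.mpr h) u)).val := by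
  unfold pick pidx
  rw [dif_pos h]

lemma pick_mem {d : ℕ} (S : Finset (V d)) (h : S.Nonempty) (u : ℝ) : pick S u ∈ S := by
  rw [pick_eq S h]; exact Subtype.property _

lemma measurable_pick {d : ℕ} (S : Finset (V d)) : Measurable (pick S) := by
  by_cases h : S.Nonempty
  · have : pick S = (fun j => (S.equivFin.symm j).val) ∘ pidx S.card (Finset.card_pos.mpr h) := by
      funext u; exact pick_eq S h u
    rw [this]
    exact (measurable_of_countable _).comp (measurable_pidx _ _)
  · have : pick S = fun _ => 0 := by
      funext u; unfold pick; rw [dif_neg h]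
    rw [this]
    exact measurable_const

lemma lintegral_pick {d : ℕ} (S : Finset (V d)) (h : S.Nonempty) (f : V d → ℝ≥0∞) :
    ∫⁻ u, f (pick S u) ∂μ0 = (∑ s ∈ S, f s) * (S.card : ℝ≥0∞)⁻¹ := by
  have hc := Finset.card_pos.mpr h
  simp_rw [pick_eq S h]
  have hm := measurable_pidx S.card hc
  rw [← lintegral_map (f := fun j => f (S.equivFin.symm j).val) (measurable_of_countable _) hm]
  rw [lintegral_fintype, Finset.sum_mul]
  have : ∀ j, (μ0.map (pidx S.card hc)) {j} = (S.card : ℝ≥0∞)⁻¹ := by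
    intro j
    rw [Measure.map_apply hm (measurableSet_singleton _), ← mu0_cell S.card j hc j.2]
    congr 1
    ext u
    simp [pidx, Fin.ext_iff]
  simp_rw [this]
  rw [← Finset.sum_coe_sort S]
  exact Equiv.sum_comp S.equivFin.symm (fun s : S => f s * (S.card : ℝ≥0∞)⁻¹)

lemma mu0_threshold (p : ℝ) (h0 : 0 ≤ p) (h1 : p ≤ 1) : μ0 {u | u ≤ p} = ENNReal.ofReal p := by
  unfold μ0
  rw [Measure.restrict_apply' measurableSet_Icc]
  have : {u : ℝ | u ≤ p} ∩ Set.Icc 0 1 = Set.Icc 0 p := by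
    ext u
    simp only [Set.mem_inter_iff, Set.mem_ofPred_eq, Set.mem_Icc]
    constructor
    · rintro ⟨h, h', _⟩; exact ⟨h', h⟩
    · rintro ⟨h, h'⟩; exact ⟨h', h, h'.trans h1⟩
  rw [this, Real.volume_Icc, sub_zero]

/-! ### The discrete averaging operator -/

/-- The map parametrizing the unit vectors. -/
def uvec {d : ℕ} (p : Fin d × Bool) : V d := fun j => if j = p.1 then (if p.2 then 1 else -1) else 0

lemma uvec_inj {d : ℕ} : Function.Injective (uvec (d := d)) := by
  rintro ⟨i, b⟩ ⟨i', b'⟩ h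
  have h1 := congrFun h i
  simp only [uvec, if_true] at h1
  have hi : i = i' := by
    by_contra hne
    rw [if_neg hne] at h1
    cases b <;> simp at h1
  subst hi
  cases b <;> cases b' <;> simp_all

lemma unitVecs_eq (d : ℕ) : unitVecs d = Finset.image uvec (Finset.univ : Finset (Fin d × Bool)) := rfl

lemma sum_unitVecs {d : ℕ} {β : Type} [AddCommMonoid β] (f : V d → β) :
    ∑ e ∈ unitVecs d, f e = ∑ i : Fin d, (f (uvec (i, true)) + f (uvec (i, false))) := by
  rw [unitVecs_eq, Finset.sum_image (fun _ _ _ _ h => uvec_inj h), Fintype.sum_prod_type]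
  simp

lemma card_unitVecs (d : ℕ) : (unitVecs d).card = 2 * d := by
  rw [unitVecs_eq, Finset.card_image_of_injective _ uvec_inj]
  simp [mul_comm]

lemma unitVecs_nonempty {d : ℕ} (hd : 0 < d) : (unitVecs d).Nonempty := by
  rw [← Finset.card_pos, card_unitVecs]; omega

lemma neg_mem_unitVecs {d : ℕ} {e : V d} (he : e ∈ unitVecs d) : -e ∈ unitVecs d := by
  rw [unitVecs_eq] at *
  simp only [Finset.mem_image, Finset.mem_univ, true_and] at *
  obtain ⟨⟨i, b⟩, rfl⟩ := he
  refine ⟨(i, !b), ?_⟩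
  funext j
  simp only [uvec, Pi.neg_apply]
  split_ifs <;> simp_all

/-- Average over neighbours. -/
noncomputable def av {d : ℕ} (f : V d → ℝ) (x : V d) : ℝ := (∑ e ∈ unitVecs d, f (x + e)) / (2 * d)

/-- Squared Euclidean norm. -/
def nsq {d : ℕ} (x : V d) : ℝ := ∑ i, (x i : ℝ) ^ 2

lemma nsq_nonneg {d : ℕ} (x : V d) : 0 ≤ nsq x := Finset.sum_nonneg fun _ _ => sq_nonneg _

lemma nsq_uvec {d : ℕ} (x : V d) (i : Fin d) (b : Bool) :
    nsq (x + uvec (i, b)) = nsq x + (if b then 2 * (x i : ℝ) else - (2 * (x i : ℝ))) + 1 := by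
  unfold nsq
  have : ∀ j, (((x + uvec (i, b)) j : ℤ) : ℝ) ^ 2 =
      (x j : ℝ) ^ 2 + (if j = i then (if b then 2 * (x i : ℝ) else - (2 * (x i : ℝ))) + 1 else 0) := by
    intro j
    simp only [Pi.add_apply, uvec]
    by_cases h : j = i
    · subst h
      cases b <;> simp <;> ring
    · simp [h]
  simp_rw [this, Finset.sum_add_distrib]
  simp [add_assoc]

lemma av_mono {d : ℕ} {f g : V d → ℝ} {x : V d} (h : ∀ e ∈ unitVecs d, f (x + e) ≤ g (x + e)) :
    av f x ≤ av g x := by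
  unfold av
  gcongr with e he
  exact h e he

lemma av_const {d : ℕ} (hd : 0 < d) (c : ℝ) (x : V d) : av (fun _ => c) x = c := by
  unfold av
  rw [Finset.sum_const, card_unitVecs, nsmul_eq_mul]
  have : (0 : ℝ) < d := by exact_mod_cast hd
  push_cast
  field_simp

lemma av_add {d : ℕ} (f g : V d → ℝ) (x : V d) : av (fun y => f y + g y) x = av f x + av g x := by
  unfold av
  rw [Finset.sum_add_distrib, add_div]

lemma av_smul {d : ℕ} (c : ℝ) (f : V d → ℝ) (x : V d) : av (fun y => c * f y) x = c * av f x := by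
  unfold av
  rw [← Finset.mul_sum, mul_div_assoc]

lemma av_sub {d : ℕ} (f g : V d → ℝ) (x : V d) : av (fun y => f y - g y) x = av f x - av g x := by
  unfold av
  rw [Finset.sum_sub_distrib, sub_div]

lemma av_nonneg {d : ℕ} {f : V d → ℝ} {x : V d} (h : ∀ e ∈ unitVecs d, 0 ≤ f (x + e)) : 0 ≤ av f x := by
  unfold av
  have := Finset.sum_nonneg h
  positivity

lemma av_nsq {d : ℕ} (hd : 0 < d) (x : V d) : av nsq x = nsq x + 1 := by
  unfold av
  rw [sum_unitVecs]
  have : (0 : ℝ) < d := by exact_mod_cast hd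
  have h2 : ∀ i : Fin d, nsq (x + uvec (i, true)) + nsq (x + uvec (i, false)) = 2 * (nsq x + 1) := by
    intro i; rw [nsq_uvec, nsq_uvec]; simp; ring
  rw [Finset.sum_congr rfl (fun i _ => h2 i)]
  rw [Finset.sum_const, Finset.card_univ, Fintype.card_fin, nsmul_eq_mul]
  field_simp

lemma lintegral_step {d : ℕ} (hd : 0 < d) (g : V d → ℝ) (y : V d) (hg : ∀ e ∈ unitVecs d, 0 ≤ g (y + e)) :
    ∫⁻ u, ENNReal.ofReal (g (y + pick (unitVecs d) u)) ∂μ0 = ENNReal.ofReal (av g y) := by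
  rw [lintegral_pick (unitVecs d) (unitVecs_nonempty hd) (fun e => ENNReal.ofReal (g (y + e)))]
  unfold av
  rw [← ENNReal.ofReal_sum_of_nonneg hg, div_eq_mul_inv, ENNReal.ofReal_mul (Finset.sum_nonneg hg),
    card_unitVecs]
  congr 1
  have : (0 : ℝ) < d := by exact_mod_cast hd
  rw [ENNReal.ofReal_inv_of_pos (by positivity)]
  congr 1
  push_cast
  rw [ENNReal.ofReal_mul (by norm_num)]
  simp

/-! ### The stopped walk -/

open Classical in
/-- One step of the walk frozen outside `S`. -/
noncomputable def fstep {d : ℕ} (S : Finset (V d)) (_ : ℕ) (y : V d) (u : ℝ) : V d :=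
  if y ∈ S then y + pick (unitVecs d) u else y

lemma measurable_fstep {d : ℕ} (S : Finset (V d)) (k : ℕ) (y : V d) : Measurable (fstep S k y) := by
  unfold fstep
  by_cases h : y ∈ S
  · simp only [h, if_true]
    exact (measurable_of_countable (fun e : V d => y + e)).comp (measurable_pick _)
  · simp only [h, if_false]
    exact measurable_const

lemma walk_succ {d : ℕ} (x : V d) (ω : ℝ) (t : ℕ) :
    walk x ω (t + 1) = walk x ω t + pick (unitVecs d) (uSlice ω t) := by
  unfold walk
  rw [Finset.sum_range_succ, add_assoc]

lemma frozen_eq_walk {d : ℕ} (S : Finset (V d)) (x : V d) (ω : ℝ) (t : ℕ)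
    (h : ∀ s < t, walk x ω s ∈ S) : chain (fstep S) x ω t = walk x ω t := by
  induction t with
  | zero => simp [chain, walk]
  | succ t ih =>
    have := ih fun s hs => h s (by omega)
    simp only [chain]
    rw [this, walk_succ, fstep, if_pos (h t (by omega))]

lemma frozen_eq_hit {d : ℕ} (S : Finset (V d)) (x : V d) (ω : ℝ) (hex : ∃ t, walk x ω t ∉ S) :
    hitPt S x ω ∉ S ∧ ∀ t, exitT S x ω ≤ t → chain (fstep S) x ω t = hitPt S x ω := by
  have hne : {t | walk x ω t ∉ S}.Nonempty := hex
  have h1 : hitPt S x ω ∉ S := Nat.sInf_mem hne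
  have h2 : ∀ s < exitT S x ω, walk x ω s ∈ S := by
    intro s hs
    by_contra hc
    have : exitT S x ω ≤ s := Nat.sInf_le hc
    omega
  refine ⟨h1, fun t ht => ?_⟩
  induction t, ht using Nat.le_induction with
  | base => exact frozen_eq_walk S x ω _ h2
  | succ t ht ih =>
    simp only [chain]
    rw [ih, fstep, if_neg h1]

lemma frozen_mem {d : ℕ} (S : Finset (V d)) (x : V d) (ω : ℝ) (hex : ¬ ∃ t, walk x ω t ∉ S) (t : ℕ) :
    chain (fstep S) x ω t ∈ S := by
  push Not at hex
  rw [frozen_eq_walk S x ω t fun s _ => hex s]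
  exact hex t

lemma measurable_walk {d : ℕ} (x : V d) (t : ℕ) : Measurable (fun ω => walk x ω t) := by
  induction t with
  | zero => simp only [walk, Finset.range_zero, Finset.sum_empty]; exact measurable_const
  | succ t ih =>
    simp_rw [walk_succ]
    exact (measurable_of_countable (fun p : V d × V d => p.1 + p.2)).comp
      (ih.prodMk ((measurable_pick _).comp (measurable_uSlice t)))

lemma measurable_exitT {d : ℕ} (S : Finset (V d)) (x : V d) : Measurable (exitT S x) := by
  apply measurable_to_countable'
  intro t
  have hm : ∀ s, MeasurableSet {ω | walk x ω s ∉ S} := fun s =>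
    measurable_walk x s (MeasurableSet.of_discrete (s := {y | y ∉ S}))
  have : exitT S x ⁻¹' {t} = ({ω | walk x ω t ∉ S} ∩ ⋂ s ∈ Finset.range t, {ω | walk x ω s ∉ S}ᶜ) ∪
      ((⋂ s, {ω | walk x ω s ∉ S}ᶜ) ∩ {_ω | t = 0}) := by
    ext ω
    simp only [Set.mem_preimage, Set.mem_singleton_iff, Set.mem_union, Set.mem_inter_iff,
      Set.mem_ofPred_eq, Set.mem_iInter, Set.mem_compl_iff, Finset.mem_range, not_not]
    unfold exitT
    constructor
    · intro h
      by_cases hne : {t | walk x ω t ∉ S}.Nonempty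
      · left
        have h1 := Nat.sInf_mem hne
        rw [h] at h1
        refine ⟨h1, fun s hs => ?_⟩
        by_contra hc
        have := Nat.sInf_le (s := {t | walk x ω t ∉ S}) (m := s) hc
        omega
      · right
        rw [Set.not_nonempty_iff_eq_empty] at hne
        constructor
        · intro s
          by_contra hc
          have : s ∈ ({t | walk x ω t ∉ S} : Set ℕ) := hc
          rw [hne] at this
          exact this
        · rw [hne] at h; simpa using h.symm
    · rintro (⟨h1, h2⟩ | ⟨h1, h2⟩)
      · apply le_antisymm
        · exact Nat.sInf_le h1
        · have h3 := Nat.sInf_mem (s := {t | walk x ω t ∉ S}) ⟨t, h1⟩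
          by_contra hc
          exact h3 (h2 _ (by omega))
      · have : {t | walk x ω t ∉ S} = ∅ := by
          ext s; simpa using h1 s
        rw [this]; simpa using h2.symm
  rw [this]
  refine ((hm t).inter (Finset.measurableSet_biInter _ fun s _ => (hm s).compl)).union
    ((MeasurableSet.iInter fun s => (hm s).compl).inter (MeasurableSet.const _))

lemma measurable_hitPt {d : ℕ} (S : Finset (V d)) (x : V d) : Measurable (hitPt S x) := by
  apply measurable_to_countable'
  intro y
  have : hitPt S x ⁻¹' {y} = ⋃ t, (exitT S x ⁻¹' {t} ∩ (fun ω => walk x ω t) ⁻¹' {y}) := by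
    ext ω
    simp only [Set.mem_preimage, Set.mem_singleton_iff, Set.mem_iUnion, Set.mem_inter_iff]
    constructor
    · intro h
      exact ⟨exitT S x ω, rfl, h⟩
    · rintro ⟨t, rfl, h⟩
      exact h
  rw [this]
  exact MeasurableSet.iUnion fun t => (measurable_exitT S x (measurableSet_singleton t)).inter
    (measurable_walk x t (measurableSet_singleton y))

lemma frozen_time {d : ℕ} (hd : 0 < d) (S : Finset (V d)) (x : V d) :
    ∃ C : ℝ, ∀ t : ℕ, (t : ℝ≥0∞) * μ0 {ω | chain (fstep S) x ω t ∈ S} ≤ ENNReal.ofReal C := by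
  classical
  obtain ⟨C, hC⟩ : ∃ C : ℝ, C = ∑ y ∈ S, ∑ e ∈ unitVecs d, nsq (y + e) := ⟨_, rfl⟩
  have hCb : ∀ y ∈ S, ∀ e ∈ unitVecs d, 0 ≤ C - nsq (y + e) := by
    rw [hC]
    intro y hy e he
    have h1 : ∑ e ∈ unitVecs d, nsq (y + e) ≤ ∑ y ∈ S, ∑ e ∈ unitVecs d, nsq (y + e) :=
      Finset.single_le_sum (f := fun y => ∑ e ∈ unitVecs d, nsq (y + e))
        (fun y _ => Finset.sum_nonneg fun e _ => nsq_nonneg _) hy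
    have h2 : nsq (y + e) ≤ ∑ e ∈ unitVecs d, nsq (y + e) :=
      Finset.single_le_sum (f := fun e => nsq (y + e)) (fun e _ => nsq_nonneg _) he
    linarith
  refine ⟨C - nsq x, fun t => ?_⟩
  have hsup := chain_super (fstep S) (measurable_fstep S) x t (fun _ _ => True)
    (fun t y => ENNReal.ofReal (C - nsq y) + if y ∈ S then (t : ℝ≥0∞) else 0) trivial
    (fun _ _ _ _ => trivial) ?_
  · have h0 : (ENNReal.ofReal (C - nsq x) + if x ∈ S then ((0 : ℕ) : ℝ≥0∞) else 0) = ENNReal.ofReal (C - nsq x) := by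
      simp
    rw [h0] at hsup
    refine le_trans ?_ hsup
    have hm : MeasurableSet {ω | chain (fstep S) x ω t ∈ S} :=
      measurable_chain _ (measurable_fstep S) x t (MeasurableSet.of_discrete (s := {y | y ∈ S}))
    rw [← lintegral_indicator_const hm]
    apply lintegral_mono
    intro ω
    simp only [Set.indicator, Set.mem_ofPred_eq]
    exact le_add_self
  · intro t _ y _
    by_cases hy : y ∈ S
    · simp only [fstep, hy, if_true]
      have hb : ∫⁻ u, (ENNReal.ofReal (C - nsq (y + pick (unitVecs d) u)) +
          if y + pick (unitVecs d) u ∈ S then ((t + 1 : ℕ) : ℝ≥0∞) else 0) ∂μ0 ≤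
          ∫⁻ u, (ENNReal.ofReal (C - nsq (y + pick (unitVecs d) u)) + ((t + 1 : ℕ) : ℝ≥0∞)) ∂μ0 := by
        apply lintegral_mono
        intro u
        simp only
        gcongr
        split_ifs <;> simp
      refine hb.trans ?_
      rw [lintegral_add_right _ measurable_const, lintegral_const, measure_univ, mul_one,
        lintegral_step hd (fun y => C - nsq y) y (hCb y hy)]
      have hav := av_nonneg (f := fun y => C - nsq y) (x := y) (hCb y hy)
      rw [av_sub, av_const hd, av_nsq hd] at *
      push_cast
      rw [← ENNReal.ofReal_one, ← ENNReal.ofReal_natCast, ← ENNReal.ofReal_add (by positivity) (by norm_num),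
        ← ENNReal.ofReal_add hav (by positivity), ← ENNReal.ofReal_add (by linarith) (by positivity)]
      apply ENNReal.ofReal_le_ofReal
      linarith
    · simp [fstep, hy]

lemma exit_ae {d : ℕ} (hd : 0 < d) (S : Finset (V d)) (x : V d) :
    ∀ᵐ ω ∂μ0, ∃ t, walk x ω t ∉ S := by
  obtain ⟨C, hC⟩ := frozen_time hd S x
  rw [ae_iff]
  by_contra hne
  set p := μ0 {ω | ¬ ∃ t, walk x ω t ∉ S} with hp
  have hb : ∀ t : ℕ, (t : ℝ≥0∞) * p ≤ ENNReal.ofReal C := by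
    intro t
    refine le_trans ?_ (hC t)
    gcongr
    exact measure_mono (fun ω h => frozen_mem S x ω h t)
  have hp1 : p ≠ ⊤ := measure_ne_top _ _
  obtain ⟨t, ht⟩ := ENNReal.exists_nat_mul_gt hne (b := ENNReal.ofReal C) ENNReal.ofReal_ne_top
  exact absurd (hb t) (not_le.2 ht)

lemma hit_super {d : ℕ} (hd : 0 < d) (S : Finset (V d)) (g : V d → ℝ) (hg : ∀ y, 0 ≤ g y)
    (hsup : ∀ y ∈ S, av g y ≤ g y) (x : V d) :
    ∫⁻ ω, ENNReal.ofReal (g (hitPt S x ω)) ∂μ0 ≤ ENNReal.ofReal (g x) := by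
  have hk : ∀ t : ℕ, ∫⁻ ω, ENNReal.ofReal (g (chain (fstep S) x ω t)) ∂μ0 ≤ ENNReal.ofReal (g x) := by
    intro t
    refine chain_super (fstep S) (measurable_fstep S) x t (fun _ _ => True)
      (fun _ y => ENNReal.ofReal (g y)) trivial (fun _ _ _ _ => trivial) ?_
    intro t _ y _
    by_cases hy : y ∈ S
    · simp only [fstep, hy, if_true]
      rw [lintegral_step hd g y (fun _ _ => hg _)]
      exact ENNReal.ofReal_le_ofReal (hsup y hy)
    · simp [fstep, hy]
  calc ∫⁻ ω, ENNReal.ofReal (g (hitPt S x ω)) ∂μ0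
      ≤ ∫⁻ ω, liminf (fun t => ENNReal.ofReal (g (chain (fstep S) x ω t))) atTop ∂μ0 := by
        apply lintegral_mono_ae
        filter_upwards [exit_ae hd S x] with ω hω
        have h2 := (frozen_eq_hit S x ω hω).2
        have : Tendsto (fun t => ENNReal.ofReal (g (chain (fstep S) x ω t))) atTop
            (nhds (ENNReal.ofReal (g (hitPt S x ω)))) := by
          apply tendsto_const_nhds.congr'
          filter_upwards [eventually_ge_atTop (exitT S x ω)] with t ht
          rw [h2 t ht]
        rw [this.liminf_eq]
    _ ≤ liminf (fun t => ∫⁻ ω, ENNReal.ofReal (g (chain (fstep S) x ω t)) ∂μ0) atTop := by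
        apply lintegral_liminf_le
        intro t
        exact (measurable_of_countable (fun y => ENNReal.ofReal (g y))).comp
          (measurable_chain _ (measurable_fstep S) x t)
    _ ≤ ENNReal.ofReal (g x) := by
        refine liminf_le_of_frequently_le' (Frequently.of_forall hk)

/-! ### Discrete potential theory -/

lemma mem_unitVecs_iff {d : ℕ} {e : V d} : e ∈ unitVecs d ↔ ∃ i b, uvec (i, b) = e := by
  rw [unitVecs_eq]
  simp

lemma coord_sq_le {d : ℕ} (x : V d) (i : Fin d) : (x i : ℝ) ^ 2 ≤ nsq x :=
  Finset.single_le_sum (f := fun i => (x i : ℝ) ^ 2) (fun _ _ => sq_nonneg _) (Finset.mem_univ i)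

lemma mem_ball {d : ℕ} {r : ℝ} (hr : 0 ≤ r) (y : V d) : y ∈ ball d r ↔ nsq y ≤ r ^ 2 := by
  unfold ball
  rw [Finset.mem_filter, Real.sqrt_le_left hr]
  refine ⟨fun h => h.2, fun h => ⟨?_, h⟩⟩
  have hi : ∀ i, |(y i : ℝ)| ≤ r := fun i =>
    abs_le_of_sq_le_sq ((coord_sq_le y i).trans h) hr
  rw [Finset.mem_Icc]
  constructor
  · intro i
    have h1 := (abs_le.1 (hi i)).1
    have h2 := Int.le_ceil r
    have : (-(⌈r⌉ : ℤ) : ℝ) ≤ (y i : ℝ) := by linarith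
    exact_mod_cast this
  · intro i
    have h1 := (abs_le.1 (hi i)).2
    have h2 := Int.le_ceil r
    have : (y i : ℝ) ≤ (⌈r⌉ : ℝ) := by linarith
    exact_mod_cast this

lemma mem_ball_nonneg {d : ℕ} {r : ℝ} {y : V d} (h : y ∈ ball d r) : 0 ≤ r := by
  unfold ball at h
  rw [Finset.mem_filter] at h
  exact (Real.sqrt_nonneg _).trans h.2

open Classical in
/-- Iterations converging to the hitting probability of `z` before leaving `D`. -/
noncomputable def HK {d : ℕ} (D : Finset (V d)) (z : V d) : ℕ → V d → ℝ
  | 0 => fun x => if x = z then 1 else 0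
  | k + 1 => fun x => if x = z then 1 else if x ∈ D then av (HK D z k) x else 0

lemma HK_bounds {d : ℕ} (hd : 0 < d) (D : Finset (V d)) (z : V d) (k : ℕ) (x : V d) :
    0 ≤ HK D z k x ∧ HK D z k x ≤ 1 := by
  induction k generalizing x with
  | zero => simp only [HK]; split_ifs <;> norm_num
  | succ k ih =>
    simp only [HK]
    split_ifs
    · norm_num
    · refine ⟨av_nonneg fun e _ => (ih _).1, ?_⟩
      rw [← av_const hd 1 x]
      exact av_mono fun e _ => (ih _).2
    · norm_num

lemma HK_mono {d : ℕ} (hd : 0 < d) (D : Finset (V d)) (z : V d) (k : ℕ) (x : V d) :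
    HK D z k x ≤ HK D z (k + 1) x := by
  induction k generalizing x with
  | zero =>
    have h := HK_bounds hd D z 1 x
    by_cases hx : x = z
    · simp [HK, hx]
    · have h0 : HK D z 0 x = 0 := by simp [HK, hx]
      rw [h0]; exact h.1
  | succ k ih =>
    rw [HK, HK]
    beta_reduce
    split_ifs
    · exact le_rfl
    · exact av_mono fun e _ => ih _
    · exact le_rfl

lemma exists_H {d : ℕ} (hd : 0 < d) (D : Finset (V d)) (z : V d) (hz : z ∈ D) :
    ∃ H : V d → ℝ, (∀ x, 0 ≤ H x) ∧ (∀ x, H x ≤ 1) ∧ H z = 1 ∧ (∀ x, x ∉ D → H x = 0) ∧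
      (∀ x ∈ D, x ≠ z → av H x = H x) ∧
      (∀ f : V d → ℝ, (∀ x ∈ D, ∀ e ∈ unitVecs d, 0 ≤ f (x + e)) → 1 ≤ f z →
        (∀ x ∈ D, x ≠ z → av f x ≤ f x) → ∀ x, 0 ≤ f x → H x ≤ f x) := by
  have hlim : ∀ x, ∃ h, Tendsto (fun k => HK D z k x) atTop (nhds h) := fun x =>
    ⟨_, tendsto_atTop_ciSup (monotone_nat_of_le_succ fun k => HK_mono hd D z k x)
      ⟨1, by rintro _ ⟨k, rfl⟩; exact (HK_bounds hd D z k x).2⟩⟩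
  choose H hH using hlim
  refine ⟨H, fun x => ge_of_tendsto' (hH x) fun k => (HK_bounds hd D z k x).1,
    fun x => le_of_tendsto' (hH x) fun k => (HK_bounds hd D z k x).2, ?_, ?_, ?_, ?_⟩
  · refine tendsto_nhds_unique (hH z) (tendsto_const_nhds.congr fun k => ?_)
    cases k <;> simp [HK]
  · intro x hx
    have hxz : x ≠ z := fun h => hx (h ▸ hz)
    refine tendsto_nhds_unique (hH x) (tendsto_const_nhds.congr fun k => ?_)
    cases k <;> simp [HK, hx, hxz]
  · intro x hx hxz
    refine tendsto_nhds_unique ?_ ((tendsto_add_atTop_iff_nat 1).2 (hH x))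
    have : Tendsto (fun k => av (HK D z k) x) atTop (nhds (av H x)) := by
      unfold av
      exact (tendsto_finsetSum _ fun e _ => hH (x + e)).div_const _
    refine this.congr fun k => ?_
    simp [HK, hx, hxz]
  · intro f hf hfz hsup x hx
    refine le_of_tendsto' (hH x) fun k => ?_
    induction k generalizing x with
    | zero =>
      simp only [HK]
      split_ifs with h
      · rw [h]; exact hfz
      · exact hx
    | succ k ih =>
      simp only [HK]
      split_ifs with h h'
      · rw [h]; exact hfz
      · exact (av_mono fun e he => ih _ (hf x h' e he)).trans (hsup x h' h)
      · exact hx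

lemma one_sub_sum_le_prod' {ι : Type} (s : Finset ι) (b : ι → ℝ) (h0 : ∀ i, 0 ≤ b i) (h1 : ∀ i, b i ≤ 1) :
    1 - ∑ i ∈ s, b i ≤ ∏ i ∈ s, (1 - b i) := by
  classical
  have hle : ∀ s : Finset ι, ∏ i ∈ s, (1 - b i) ≤ 1 := fun s =>
    Finset.prod_le_one (fun i _ => by linarith [h1 i]) (fun i _ => by linarith [h0 i])
  induction s using Finset.induction_on with
  | empty => simp
  | insert a s ha ih =>
    rw [Finset.sum_insert ha, Finset.prod_insert ha]
    nlinarith [h0 a, hle s]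

/-- Discrete subharmonicity of the logarithm. -/
lemma log_sub {d : ℕ} (hd : 2 ≤ d) (y : V d) :
    Real.log (1 + nsq y) ≤ av (fun x => Real.log (1 + nsq x)) y := by
  have hd' : (2 : ℝ) ≤ d := by exact_mod_cast hd
  obtain ⟨t, ht⟩ : ∃ t, t = nsq y + 2 := ⟨_, rfl⟩
  have hρ := nsq_nonneg y
  have ht2 : 2 ≤ t := by linarith
  have hpos : ∀ i, 0 < t ^ 2 - 4 * (y i : ℝ) ^ 2 := by
    intro i
    have := coord_sq_le y i
    have h1 : (y i : ℝ) ^ 2 + 2 ≤ t := by linarith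
    nlinarith [sq_nonneg ((y i : ℝ) ^ 2), sq_nonneg (y i : ℝ)]
  have hterm : ∀ i, Real.log (1 + nsq (y + uvec (i, true))) + Real.log (1 + nsq (y + uvec (i, false))) =
      Real.log (t ^ 2 - 4 * (y i : ℝ) ^ 2) := by
    intro i
    rw [← Real.log_mul (by have := nsq_nonneg (y + uvec (i, true)); positivity)
      (by have := nsq_nonneg (y + uvec (i, false)); positivity), nsq_uvec, nsq_uvec, ht]
    congr 1
    simp
    ring
  unfold av
  rw [sum_unitVecs, Finset.sum_congr rfl (fun i _ => hterm i), le_div_iff₀ (by positivity)]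
  have hprod : 1 - 4 * nsq y / t ^ 2 ≤ ∏ i, (1 - 4 * (y i : ℝ) ^ 2 / t ^ 2) := by
    have h := one_sub_sum_le_prod' (Finset.univ : Finset (Fin d)) (fun i => 4 * (y i : ℝ) ^ 2 / t ^ 2)
      (fun i => by positivity) (fun i => by
        rw [div_le_one (by positivity)]
        linarith [hpos i])
    refine le_trans (le_of_eq ?_) h
    rw [← Finset.sum_div, ← Finset.mul_sum]
    rfl
  have hbase : (1 - 1 / t) ^ (2 * d) ≤ 1 - 4 * nsq y / t ^ 2 := by
    have h1 : (1 - 1 / t) ^ (2 * d) ≤ (1 - 1 / t) ^ 4 := by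
      apply pow_le_pow_of_le_one
      · have : 1 / t ≤ 1 := by rw [div_le_one (by linarith)]; linarith
        linarith
      · have : 0 ≤ 1 / t := by positivity
        linarith
      · omega
    refine h1.trans ?_
    have : nsq y = t - 2 := by linarith
    rw [this]
    have e1 : (1 - 1 / t) ^ 4 = (t - 1) ^ 4 / t ^ 4 := by
      have : t ≠ 0 := by positivity
      field_simp
    have e2 : 1 - 4 * (t - 2) / t ^ 2 = (t ^ 2 * (t ^ 2 - 4 * (t - 2))) / t ^ 4 := by
      have : t ≠ 0 := by positivity
      field_simp
    rw [e1, e2]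
    gcongr
    nlinarith
  have hlog : ∑ i, Real.log (t ^ 2 - 4 * (y i : ℝ) ^ 2) =
      Real.log (t ^ (2 * d) * ∏ i, (1 - 4 * (y i : ℝ) ^ 2 / t ^ 2)) := by
    rw [← Real.log_prod (fun i _ => (hpos i).ne')]
    congr 1
    have : t ^ (2 * d) = ∏ i : Fin d, t ^ 2 := by
      rw [Finset.prod_const, Finset.card_univ, Fintype.card_fin, pow_mul]
    rw [this, ← Finset.prod_mul_distrib]
    apply Finset.prod_congr rfl
    intro i _
    have : t ≠ 0 := by positivity
    field_simp
  rw [hlog]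
  have h3 : Real.log (1 + nsq y) * (2 * d) = Real.log ((t - 1) ^ (2 * d)) := by
    rw [Real.log_pow, ht]
    push_cast
    rw [mul_comm]
    congr 2
    ring
  rw [h3]
  apply Real.log_le_log (by have : 0 < t - 1 := by linarith
                            positivity)
  have : (t - 1) ^ (2 * d) = t ^ (2 * d) * (1 - 1 / t) ^ (2 * d) := by
    rw [← mul_pow]
    congr 1
    have : t ≠ 0 := by positivity
    field_simp
  rw [this]
  gcongr
  exact hbase.trans hprod

/-- Neighbourhood. -/
lemma parts {d : ℕ} (D D' : Finset (V d)) (hDD : D ⊆ D')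
    (hD' : ∀ x ∈ D, ∀ e ∈ unitVecs d, x + e ∈ D')
    (H w : V d → ℝ) (hH : ∀ x, x ∉ D → H x = 0) :
    ∑ x ∈ D, (av w x - w x) * H x = ∑ x ∈ D', w x * (av H x - H x) := by
  classical
  have h1 : ∀ e ∈ unitVecs d, ∑ x ∈ D, w (x + e) * H x = ∑ y ∈ D', w y * H (y + -e) := by
    intro e he
    have : ∑ x ∈ D, w (x + e) * H x = ∑ y ∈ D.image (fun x => x + e), w y * H (y + -e) := by
      rw [Finset.sum_image (fun a _ b _ h => add_right_cancel h)]
      simp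
    rw [this]
    apply Finset.sum_subset
    · intro y hy
      rw [Finset.mem_image] at hy
      obtain ⟨x, hx, rfl⟩ := hy
      exact hD' x hx e he
    · intro y _ hy
      rw [hH, mul_zero]
      intro hc
      apply hy
      rw [Finset.mem_image]
      exact ⟨_, hc, by simp⟩
  have h2 : ∑ x ∈ D, w x * H x = ∑ x ∈ D', w x * H x :=
    Finset.sum_subset hDD fun x _ hx => by rw [hH x hx, mul_zero]
  have h3 : ∑ x ∈ D, av w x * H x = ∑ x ∈ D', w x * av H x := by
    unfold av
    have l : ∀ x, (∑ e ∈ unitVecs d, w (x + e)) / (2 * d) * H x =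
        (∑ e ∈ unitVecs d, w (x + e) * H x) / (2 * d) := by
      intro x; rw [← Finset.sum_mul]; ring
    have r : ∀ x, w x * ((∑ e ∈ unitVecs d, H (x + e)) / (2 * d)) =
        (∑ e ∈ unitVecs d, w x * H (x + -e)) / (2 * d) := by
      intro x
      have : ∑ e ∈ unitVecs d, H (x + e) = ∑ e ∈ unitVecs d, H (x + -e) :=
        Finset.sum_nbij' (fun e => -e) (fun e => -e) (fun e he => neg_mem_unitVecs he)
          (fun e he => neg_mem_unitVecs he) (by simp) (by simp) (by simp)
      rw [this, ← Finset.mul_sum]; ring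
    simp_rw [l, r, ← Finset.sum_div]
    rw [Finset.sum_comm, Finset.sum_comm (s := D')]
    rw [Finset.sum_congr rfl h1]
  calc ∑ x ∈ D, (av w x - w x) * H x = ∑ x ∈ D, av w x * H x - ∑ x ∈ D, w x * H x := by
        rw [← Finset.sum_sub_distrib]; exact Finset.sum_congr rfl fun x _ => by ring
    _ = _ := by
        rw [h2, h3, ← Finset.sum_sub_distrib]; exact Finset.sum_congr rfl fun x _ => by ring

lemma parts_le {d : ℕ} (hd : 0 < d) (D : Finset (V d)) (z : V d) (hz : z ∈ D) (H w : V d → ℝ)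
    (hH0 : ∀ x, 0 ≤ H x)
    (hH : ∀ x, x ∉ D → H x = 0) (hhar : ∀ x ∈ D, x ≠ z → av H x = H x) (W : ℝ)
    (hW : ∀ x ∈ D, ∀ e ∈ unitVecs d, x + e ∉ D → w (x + e) ≤ W) :
    ∑ x ∈ D, (av w x - w x) * H x ≤ (H z - av H z) * (W - w z) := by
  classical
  obtain ⟨D', hD'⟩ : ∃ D' : Finset (V d), D' = D ∪ D.biUnion fun x => (unitVecs d).image fun e => x + e :=
    ⟨_, rfl⟩
  have hDD : D ⊆ D' := by rw [hD']; exact Finset.subset_union_left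
  have h1 : ∑ x ∈ D, (av w x - w x) * H x = ∑ x ∈ D, (av (fun y => w y - W) x - (w x - W)) * H x := by
    apply Finset.sum_congr rfl
    intro x _
    rw [av_sub, av_const hd]; ring
  rw [h1, parts D D' hDD ?_ H (fun y => w y - W) hH]
  · have hzD' := hDD hz
    rw [← Finset.add_sum_erase _ _ hzD']
    have : ∑ x ∈ D'.erase z, (w x - W) * (av H x - H x) ≤ 0 := by
      apply Finset.sum_nonpos
      intro x hx
      rw [Finset.mem_erase] at hx
      by_cases hxD : x ∈ D
      · rw [hhar x hxD hx.1]; simp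
      · have hx2 := hx.2
        rw [hD', Finset.mem_union] at hx2
        rcases hx2 with h | h
        · exact absurd h hxD
        · rw [Finset.mem_biUnion] at h
          obtain ⟨y, hy, h⟩ := h
          rw [Finset.mem_image] at h
          obtain ⟨e, he, rfl⟩ := h
          have := hW y hy e he hxD
          rw [hH _ hxD]
          have hn : 0 ≤ av H (y + e) := av_nonneg fun _ _ => hH0 _
          nlinarith
    linarith
  · intro x hx e he
    rw [hD', Finset.mem_union, Finset.mem_biUnion]
    exact Or.inr ⟨x, hx, Finset.mem_image_of_mem _ he⟩

lemma nsq_unit_le {d : ℕ} {x e : V d} {R : ℝ} (hR : 0 ≤ R) (hx : nsq x ≤ R ^ 2) (he : e ∈ unitVecs d) :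
    nsq (x + e) ≤ (R + 1) ^ 2 := by
  obtain ⟨i, b, rfl⟩ := mem_unitVecs_iff.1 he
  rw [nsq_uvec]
  have h := abs_le.1 (abs_le_of_sq_le_sq ((coord_sq_le x i).trans hx) hR)
  cases b <;> simp <;> nlinarith [h.1, h.2]

lemma nsq_unit_ge {d : ℕ} {x e : V d} {r : ℝ} (hr : 1 ≤ r) (hx : r ^ 2 ≤ nsq x) (he : e ∈ unitVecs d) :
    (r - 1) ^ 2 ≤ nsq (x + e) := by
  obtain ⟨i, b, rfl⟩ := mem_unitVecs_iff.1 he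
  obtain ⟨s, hs⟩ : ∃ s, s = Real.sqrt (nsq x) := ⟨_, rfl⟩
  have hs0 : 0 ≤ s := hs ▸ Real.sqrt_nonneg _
  have hs2 : s ^ 2 = nsq x := by rw [hs, Real.sq_sqrt (nsq_nonneg x)]
  have hsr : r ≤ s := by
    rw [← hs2] at hx
    exact (sq_le_sq₀ (by linarith) hs0).1 hx
  have h := abs_le.1 (abs_le_of_sq_le_sq ((coord_sq_le x i).trans hs2.ge) hs0)
  rw [nsq_uvec, ← hs2]
  cases b <;> simp <;> nlinarith [h.1, h.2]

lemma av_psi {d : ℕ} (hd : 0 < d) (ρ0 : ℝ) (x : V d) :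
    (max (nsq x - ρ0) 0) ^ 2 ≤ av (fun y => (max (nsq y - ρ0) 0) ^ 2) x := by
  have h : ∀ e ∈ unitVecs d, (max (nsq x - ρ0) 0) ^ 2 + 2 * max (nsq x - ρ0) 0 * (nsq (x + e) - nsq x) ≤
      (max (nsq (x + e) - ρ0) 0) ^ 2 := by
    intro e _
    have h1 : nsq (x + e) - ρ0 ≤ max (nsq (x + e) - ρ0) 0 := le_max_left _ _
    have h2 : 0 ≤ max (nsq (x + e) - ρ0) 0 := le_max_right _ _
    rcases le_total (nsq x - ρ0) 0 with h3 | h3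
    · rw [max_eq_right h3]; nlinarith
    · rw [max_eq_left h3]
      nlinarith [sq_nonneg (max (nsq (x + e) - ρ0) 0 - (nsq x - ρ0))]
  have := av_mono (x := x) (f := fun y => (max (nsq x - ρ0) 0) ^ 2 + 2 * max (nsq x - ρ0) 0 * (nsq y - nsq x))
    (g := fun y => (max (nsq y - ρ0) 0) ^ 2) h
  rw [av_add, av_const hd, av_smul, av_sub, av_nsq hd, av_const hd] at this
  have h2 : 0 ≤ max (nsq x - ρ0) 0 := le_max_right _ _
  linarith

lemma av_sq {d : ℕ} (hd : 0 < d) (ρ0 : ℝ) (x : V d) :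
    av (fun y => (nsq y - ρ0) ^ 2) x = (nsq x - ρ0) ^ 2 + 2 * (nsq x - ρ0) + 4 * nsq x / d + 1 := by
  unfold av
  rw [sum_unitVecs]
  have : (0 : ℝ) < d := by exact_mod_cast hd
  have h2 : ∀ i : Fin d, (nsq (x + uvec (i, true)) - ρ0) ^ 2 + (nsq (x + uvec (i, false)) - ρ0) ^ 2 =
      2 * ((nsq x - ρ0) ^ 2 + 2 * (nsq x - ρ0) + 1) + 8 * (x i : ℝ) ^ 2 := by
    intro i; rw [nsq_uvec, nsq_uvec]; simp; ring
  rw [Finset.sum_congr rfl (fun i _ => h2 i), Finset.sum_add_distrib, ← Finset.mul_sum (f := fun i => (x i : ℝ) ^ 2)]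
  rw [Finset.sum_const, Finset.card_univ, Fintype.card_fin, nsmul_eq_mul]
  have : ∑ i, (x i : ℝ) ^ 2 = nsq x := rfl
  rw [this]
  field_simp
  ring

lemma av_shift {d : ℕ} (f : V d → ℝ) (z x : V d) : av (fun y => f (y - z)) x = av f (x - z) := by
  unfold av
  congr 1
  apply Finset.sum_congr rfl
  intro e _
  change f (x + e - z) = f (x - z + e)
  rw [sub_add_eq_add_sub]

lemma nsq_sub_le {d : ℕ} (x z : V d) : nsq (x - z) ≤ 2 * nsq x + 2 * nsq z := by
  unfold nsq
  rw [Finset.mul_sum, Finset.mul_sum, ← Finset.sum_add_distrib]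
  apply Finset.sum_le_sum
  intro i _
  simp only [Pi.sub_apply, Int.cast_sub]
  nlinarith [sq_nonneg ((x i : ℝ) + z i)]

set_option maxHeartbeats 1000000 in
lemma potential {d : ℕ} (hd : 2 ≤ d) (n : ℕ) (hn : 1 ≤ n) (e A R L : ℝ) (he : 0 < e)
    (hA : A = d * (1 + e) / (4 * n ^ 2)) (hnR : (n : ℝ) ≤ R)
    (hR : (R + 1) ^ 2 = ((n : ℝ) - 1) ^ 2 + e / (2 * A)) (z : V d) (hzn : z ∉ ball d n)
    (hzR : nsq z ≤ R ^ 2) (hL : Real.log (1 + (2 * (R + 1) ^ 2 + 2 * R ^ 2)) ≤ L) :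
    ∃ (H : V d → ℝ) (q T S : ℝ), (∀ x, 0 ≤ H x) ∧ (∀ x, H x ≤ 1) ∧ H z = 1 ∧
      (∀ x, x ∉ ball d R → H x = 0) ∧ (∀ x, x ≠ z → H x ≤ av H x) ∧
      Real.log 2 / L ≤ q ∧ T = ∑ x ∈ ball d R, H x ∧ S = ∑ x ∈ ball d n, H x ∧
      S ≤ T ∧ T ≤ q * ((R + 1) ^ 2 - nsq z) ∧
      q * (A * (R ^ 2 - nsq z) ^ 2) ≤ (1 + e) * S - T := by
  have hd0 : 0 < d := by omega
  have hdr : (0 : ℝ) < d := by exact_mod_cast hd0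
  have hn' : (1 : ℝ) ≤ n := by exact_mod_cast hn
  have hR0 : 0 ≤ R := by linarith
  have hA0 : 0 < A := by rw [hA]; positivity
  have hzD : z ∈ ball d R := (mem_ball hR0 z).2 hzR
  have hzn' : (n : ℝ) ^ 2 < nsq z := by
    by_contra hc
    exact hzn ((mem_ball (by positivity) z).2 (not_lt.1 hc))
  have hL0 : 0 < L := by
    refine lt_of_lt_of_le (Real.log_pos ?_) hL
    nlinarith
  obtain ⟨H, h0, h1, hz1, hoff, hhar, hmin⟩ := exists_H hd0 (ball d R) z hzD
  obtain ⟨q, hq⟩ : ∃ q, q = H z - av H z := ⟨_, rfl⟩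
  have hqL : Real.log 2 / L ≤ q := by
    obtain ⟨f, hf⟩ : ∃ f : V d → ℝ, f = fun x => 1 - L⁻¹ * Real.log (1 + nsq (x - z)) := ⟨_, rfl⟩
    have hLi : 0 < L⁻¹ := by positivity
    have hnn : ∀ x ∈ ball d R, ∀ e ∈ unitVecs d, 0 ≤ f (x + e) := by
      intro x hx e he
      have hx' := (mem_ball hR0 x).1 hx
      have h1 := nsq_unit_le hR0 hx' he
      have h2 := nsq_sub_le (x + e) z
      have h3 : Real.log (1 + nsq (x + e - z)) ≤ L := by
        refine le_trans (Real.log_le_log ?_ ?_) hL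
        · have := nsq_nonneg (x + e - z); positivity
        · linarith
      rw [hf]
      have : L⁻¹ * Real.log (1 + nsq (x + e - z)) ≤ L⁻¹ * L := by gcongr
      rw [inv_mul_cancel₀ hL0.ne'] at this
      simp only
      linarith
    have hfz : 1 ≤ f z := by rw [hf]; simp [nsq]
    have hsup : ∀ x ∈ ball d R, x ≠ z → av f x ≤ f x := by
      intro x _ _
      rw [hf, av_sub, av_const hd0, av_smul, av_shift (fun y => Real.log (1 + nsq y))]
      have := log_sub hd (x - z)
      have : L⁻¹ * Real.log (1 + nsq (x - z)) ≤ L⁻¹ * av (fun y => Real.log (1 + nsq y)) (x - z) := by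
        gcongr
      linarith
    have hcmp : av H z ≤ av (fun _ => 1 - Real.log 2 / L) z := by
      apply av_mono
      intro e he
      refine (hmin f hnn hfz hsup (z + e) (hnn z hzD e he)).trans ?_
      rw [hf]
      have : nsq (z + e - z) = 1 := by
        rw [add_sub_cancel_left]
        obtain ⟨i, b, rfl⟩ := mem_unitVecs_iff.1 he
        have := nsq_uvec (0 : V d) i b
        rw [zero_add] at this
        rw [this]
        simp [nsq]
      simp only [this]
      rw [div_eq_inv_mul]
      norm_num
    rw [av_const hd0] at hcmp
    linarith
  refine ⟨H, q, _, _, h0, h1, hz1, hoff, ?_, hqL, rfl, rfl, ?_, ?_, ?_⟩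
  · intro x hx
    by_cases hxD : x ∈ ball d R
    · rw [hhar x hxD hx]
    · rw [hoff x hxD]; exact av_nonneg fun _ _ => h0 _
  · apply Finset.sum_le_sum_of_subset_of_nonneg
    · intro x hx
      rw [mem_ball (by positivity)] at hx
      rw [mem_ball hR0]
      nlinarith
    · intro x _ _; exact h0 x
  · have := parts_le hd0 (ball d R) z hzD H nsq h0 hoff hhar ((R + 1) ^ 2)
      (fun x hx e he _ => nsq_unit_le hR0 ((mem_ball hR0 x).1 hx) he)
    rw [← hq] at this
    refine le_trans (le_of_eq ?_) this
    apply Finset.sum_congr rfl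
    intro x _
    rw [av_nsq hd0]; ring
  · obtain ⟨ρ0, hρ0⟩ : ∃ ρ0, ρ0 = ((n : ℝ) - 1) ^ 2 := ⟨_, rfl⟩
    obtain ⟨w, hw⟩ : ∃ w : V d → ℝ, w = fun x => (A * (max (nsq x - ρ0) 0) ^ 2 - e * (nsq x - ρ0)) := ⟨_, rfl⟩
    have havw : ∀ x, av w x - w x = A * (av (fun y => (max (nsq y - ρ0) 0) ^ 2) x -
        (max (nsq x - ρ0) 0) ^ 2) - e := by
      intro x
      rw [hw, av_sub, av_smul, av_smul, av_sub, av_nsq hd0, av_const hd0]; ring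
    have hsubset : ball d n ⊆ ball d R := by
      intro x hx
      rw [mem_ball (by positivity)] at hx
      rw [mem_ball hR0]
      nlinarith
    have hge1 : ∀ x, -e ≤ av w x - w x := by
      intro x
      rw [havw]
      nlinarith [av_psi hd0 ρ0 x]
    have hge2 : ∀ x, x ∉ ball d n → 1 ≤ av w x - w x := by
      intro x hx
      have hxn : (n : ℝ) ^ 2 < nsq x := by
        by_contra hc
        exact hx ((mem_ball (by positivity) x).2 (not_lt.1 hc))
      rw [havw]
      have heq : av (fun y => (max (nsq y - ρ0) 0) ^ 2) x = av (fun y => (nsq y - ρ0) ^ 2) x := by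
        unfold av
        congr 1
        apply Finset.sum_congr rfl
        intro e he
        have := nsq_unit_ge hn' hxn.le he
        rw [← hρ0] at this
        simp only
        rw [max_eq_left (by linarith)]
      have hv : 0 ≤ nsq x - ρ0 := by rw [hρ0]; nlinarith
      rw [heq, av_sq hd0, max_eq_left hv]
      have hkey : A * (4 * nsq x / d) ≥ 1 + e := by
        rw [hA]
        have : (d : ℝ) * (1 + e) / (4 * n ^ 2) * (4 * nsq x / d) = (1 + e) * (nsq x / n ^ 2) := by
          field_simp
        rw [this]
        have : 1 ≤ nsq x / n ^ 2 := by rw [le_div_iff₀ (by positivity)]; linarith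
        nlinarith
      nlinarith
    obtain ⟨W, hWd⟩ : ∃ W, W = A * (R ^ 2 - ρ0) ^ 2 - e * (R ^ 2 - ρ0) := ⟨_, rfl⟩
    have hstar : 2 * A * ((R + 1) ^ 2 - ρ0) = e := by
      rw [hR, hρ0]; field_simp; ring
    have hRρ : ρ0 ≤ R ^ 2 := by rw [hρ0]; nlinarith
    have hW : ∀ x ∈ ball d R, ∀ e ∈ unitVecs d, x + e ∉ ball d R → w (x + e) ≤ W := by
      intro x hx v hv hxv
      have h1 := nsq_unit_le hR0 ((mem_ball hR0 x).1 hx) hv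
      have h2 : R ^ 2 < nsq (x + v) := by
        by_contra hc
        exact hxv ((mem_ball hR0 _).2 (not_lt.1 hc))
      rw [hw, hWd]
      simp only
      rw [max_eq_left (by linarith)]
      have : A * (nsq (x + v) - ρ0) ^ 2 - e * (nsq (x + v) - ρ0) - (A * (R ^ 2 - ρ0) ^ 2 - e * (R ^ 2 - ρ0))
        = (A * (nsq (x + v) - R ^ 2)) * (nsq (x + v) + R ^ 2 - 2 * (R + 1) ^ 2) := by
        rw [← hstar]; ring
      have h3 : 0 ≤ A * (nsq (x + v) - R ^ 2) := by
        apply mul_nonneg hA0.le; linarith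
      have h4 : nsq (x + v) + R ^ 2 - 2 * (R + 1) ^ 2 ≤ 0 := by nlinarith only [hR0, h1]
      have := mul_nonpos_of_nonneg_of_nonpos h3 h4
      linarith
    have hparts := parts_le hd0 (ball d R) z hzD H w h0 hoff hhar W hW
    rw [← hq] at hparts
    have hlow : ∑ x ∈ ball d R, H x - (1 + e) * ∑ x ∈ ball d n, H x ≤
        ∑ x ∈ ball d R, (av w x - w x) * H x := by
      rw [← Finset.sum_sdiff hsubset, ← Finset.sum_sdiff hsubset (f := fun x => (av w x - w x) * H x)]
      have a1 : ∑ x ∈ ball d R \ ball d n, H x ≤ ∑ x ∈ ball d R \ ball d n, (av w x - w x) * H x := by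
        apply Finset.sum_le_sum
        intro x hx
        exact le_mul_of_one_le_left (h0 x) (hge2 x (Finset.mem_sdiff.1 hx).2)
      have a2 : -e * ∑ x ∈ ball d n, H x ≤ ∑ x ∈ ball d n, (av w x - w x) * H x := by
        rw [Finset.mul_sum]
        apply Finset.sum_le_sum
        intro x hx
        exact mul_le_mul_of_nonneg_right (hge1 x) (h0 x)
      linarith
    have hwz : A * (R ^ 2 - nsq z) ^ 2 ≤ w z - W := by
      rw [hw, hWd]
      simp only
      have : ρ0 ≤ nsq z := by rw [hρ0]; nlinarith
      rw [max_eq_left (by linarith)]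
      have : A * (nsq z - ρ0) ^ 2 - e * (nsq z - ρ0) - (A * (R ^ 2 - ρ0) ^ 2 - e * (R ^ 2 - ρ0))
        = A * (R ^ 2 - nsq z) * (2 * (R + 1) ^ 2 - nsq z - R ^ 2) := by
        rw [← hstar]; ring
      rw [this]
      have h3 : 0 ≤ A * (R ^ 2 - nsq z) := by
        apply mul_nonneg hA0.le; linarith
      have h4 : R ^ 2 - nsq z ≤ 2 * (R + 1) ^ 2 - nsq z - R ^ 2 := by nlinarith only [hR0]
      have := mul_le_mul_of_nonneg_left h4 h3
      linarith
    have hq0 : 0 ≤ q := le_trans (div_nonneg (Real.log_nonneg (by norm_num)) hL0.le) hqL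
    have : q * (A * (R ^ 2 - nsq z) ^ 2) ≤ q * (w z - W) := by gcongr
    linarith

/-! ### The probabilistic step -/

instance instDMSFinset (d : ℕ) : DiscreteMeasurableSpace (Finset (V d)) := ⟨fun _ => trivial⟩

lemma lintegral_mix {α : Type} [Countable α] [MeasurableSpace α] [DiscreteMeasurableSpace α]
    (g : ℝ → α) (hg : Measurable g) (G : α → ℝ → ℝ≥0∞) (hG : ∀ a, Measurable (G a)) :
    ∫⁻ ω, G (g (uSlice ω 0)) (uSlice ω 1) ∂μ0 = ∫⁻ u, ∫⁻ v, G (g u) v ∂μ0 ∂μ0 := by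
  have hind : ProbabilityTheory.IndepFun (fun ω => uSlice ω 0) (fun ω => uSlice ω 1) μ0 :=
    uSlice_indep.indepFun (by norm_num : (0 : ℕ) ≠ 1)
  have hF0 : Measurable (fun p : α × ℝ => G p.1 p.2) :=
    measurable_from_prod_countable_right (fun a => hG a)
  have hF : Measurable (fun p : ℝ × ℝ => G (g p.1) p.2) :=
    hF0.comp ((hg.comp measurable_fst).prodMk measurable_snd)
  have hmap := (ProbabilityTheory.indepFun_iff_map_prod_eq_prod_map_map
    (measurable_uSlice 0).aemeasurable (measurable_uSlice 1).aemeasurable).1 hind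
  rw [uSlice_law, uSlice_law] at hmap
  calc ∫⁻ ω, G (g (uSlice ω 0)) (uSlice ω 1) ∂μ0
      = ∫⁻ p, G (g p.1) p.2 ∂(μ0.map (fun ω => (uSlice ω 0, uSlice ω 1))) := by
        rw [lintegral_map hF ((measurable_uSlice 0).prodMk (measurable_uSlice 1))]
    _ = _ := by rw [hmap, lintegral_prod _ hF.aemeasurable]

lemma measurable_mix {α β : Type} [Countable α] [MeasurableSpace α] [DiscreteMeasurableSpace α]
    [MeasurableSpace β]
    (g : ℝ → α) (hg : Measurable g) (G : α → ℝ → β) (hG : ∀ a, Measurable (G a)) :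
    Measurable (fun ω => G (g (uSlice ω 0)) (uSlice ω 1)) := by
  have hF0 : Measurable (fun p : α × ℝ => G p.1 p.2) :=
    measurable_from_prod_countable_right (fun a => hG a)
  exact hF0.comp ((hg.comp (measurable_uSlice 0)).prodMk (measurable_uSlice 1))

lemma measurable_addPt {d : ℕ} (E : Finset (V d)) (x : V d) : Measurable (addPt E x) :=
  (measurable_of_countable (fun y : V d => insert y E)).comp (measurable_hitPt E x)

lemma measurable_uStep {d : ℕ} (E : Finset (V d)) : Measurable (uStep E) :=
  measurable_mix (pick E) (measurable_pick E) (addPt E) (measurable_addPt E)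

lemma measurable_decide_le (p : ℝ) : Measurable (fun u : ℝ => decide (u ≤ p)) := by
  apply measurable_to_bool
  have : (fun u : ℝ => decide (u ≤ p)) ⁻¹' {true} = Set.Iic p := by
    ext u; simp
  rw [this]
  exact measurableSet_Iic

lemma subStep_eq {d : ℕ} (m k : ℕ) (E : Finset (V d)) (hmk : 0 < (m : ℝ) + k) (ω : ℝ) :
    subStep m k E ω = (fun (b : Bool) v => if b then uStep E v else E)
      (decide (uSlice ω 0 ≤ E.card / ((m : ℝ) + k))) (uSlice ω 1) := by
  unfold subStep
  simp only [decide_eq_true_eq, le_div_iff₀ hmk]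

lemma measurable_subStep {d : ℕ} (m k : ℕ) (E : Finset (V d)) : Measurable (subStep m k E) := by
  by_cases hmk : 0 < (m : ℝ) + k
  · have : subStep m k E = fun ω => (fun (b : Bool) v => if b then uStep E v else E)
      (decide (uSlice ω 0 ≤ E.card / ((m : ℝ) + k))) (uSlice ω 1) := by
      funext ω; exact subStep_eq m k E hmk ω
    rw [this]
    refine measurable_mix (fun u => decide (u ≤ E.card / ((m : ℝ) + k))) (measurable_decide_le _)
      (fun (b : Bool) v => if b then uStep E v else E) ?_
    intro b
    cases b
    · simp
    · simpa using measurable_uStep E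
  · have h0 : (m : ℝ) + k = 0 := le_antisymm (not_lt.1 hmk) (by positivity)
    have : subStep m k E = fun ω => uStep E (uSlice ω 1) := by
      funext ω
      unfold subStep
      rw [h0, mul_zero, if_pos (by positivity)]
    rw [this]
    exact (measurable_uStep E).comp (measurable_uSlice 1)

open Classical in
/-- The exponential functional. -/
noncomputable def Phi {d : ℕ} (H : V d → ℝ) (z : V d) (l : ℝ) (E : Finset (V d)) : ℝ≥0∞ :=
  if z ∈ E then 0 else ENNReal.ofReal (Real.exp (-l * ∑ x ∈ E, H x))

lemma exp_chord {l t : ℝ} (h0 : 0 ≤ t) (h1 : t ≤ 1) :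
    Real.exp (-l * t) ≤ Real.exp (-l) + (1 - Real.exp (-l)) * (1 - t) := by
  have := convexOn_exp.2 (Set.mem_univ (0 : ℝ)) (Set.mem_univ (-l)) (by linarith : 0 ≤ 1 - t) h0 (by ring)
  simp only [smul_eq_mul, mul_zero, zero_add, Real.exp_zero, mul_one] at this
  rw [mul_comm (-l) t]
  linarith

section Step

lemma Phi_addPt {d : ℕ} (hd : 0 < d) (H : V d → ℝ) (z : V d) (l : ℝ) (hl : 0 ≤ l)
    (h0 : ∀ x, 0 ≤ H x) (h1 : ∀ x, H x ≤ 1) (hsub : ∀ x, x ≠ z → H x ≤ av H x)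
    (E : Finset (V d)) (hzE : z ∉ E) (x : V d) :
    ∫⁻ ω, Phi H z l (addPt E x ω) ∂μ0 ≤
      Phi H z l E * ENNReal.ofReal (1 - (1 - Real.exp (-l)) * H x) := by
  classical
  have hk0 : 0 ≤ 1 - Real.exp (-l) := by
    have : Real.exp (-l) ≤ 1 := Real.exp_le_one_iff.2 (by linarith)
    linarith
  have hPE : Phi H z l E = ENNReal.ofReal (Real.exp (-l * ∑ x ∈ E, H x)) := by
    simp [Phi, hzE]
  have hsuper : ∫⁻ ω, ENNReal.ofReal (1 - H (hitPt E x ω)) ∂μ0 ≤ ENNReal.ofReal (1 - H x) := by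
    apply hit_super hd E (fun y => 1 - H y) (fun y => by linarith [h1 y])
    intro y hy
    rw [av_sub, av_const hd]
    have := hsub y (fun h => hzE (h ▸ hy))
    linarith
  have hpt : ∀ᵐ ω ∂μ0, Phi H z l (addPt E x ω) ≤ Phi H z l E *
      (ENNReal.ofReal (Real.exp (-l)) +
        ENNReal.ofReal (1 - Real.exp (-l)) * ENNReal.ofReal (1 - H (hitPt E x ω))) := by
    filter_upwards [exit_ae hd E x] with ω hω
    have hh := (frozen_eq_hit E x ω hω).1
    unfold addPt
    generalize hitPt E x ω = y at hh ⊢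
    have e1 : Phi H z l (insert y E) ≤ ENNReal.ofReal (Real.exp (-l * ∑ x ∈ insert y E, H x)) := by
      unfold Phi
      split_ifs <;> simp
    refine e1.trans ?_
    rw [hPE, ← ENNReal.ofReal_mul hk0, ← ENNReal.ofReal_add (Real.exp_pos _).le
      (mul_nonneg hk0 (by linarith [h1 y])), ← ENNReal.ofReal_mul (Real.exp_pos _).le]
    apply ENNReal.ofReal_le_ofReal
    rw [Finset.sum_insert hh, mul_add, Real.exp_add, mul_comm]
    gcongr
    exact exp_chord (h0 y) (h1 y)
  refine (lintegral_mono_ae hpt).trans ?_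
  rw [lintegral_const_mul' _ _ (by rw [hPE]; exact ENNReal.ofReal_ne_top),
    lintegral_add_left measurable_const, lintegral_const, measure_univ, mul_one,
    lintegral_const_mul' _ _ ENNReal.ofReal_ne_top]
  gcongr
  calc ENNReal.ofReal (Real.exp (-l)) + ENNReal.ofReal (1 - Real.exp (-l)) *
        ∫⁻ ω, ENNReal.ofReal (1 - H (hitPt E x ω)) ∂μ0
      ≤ ENNReal.ofReal (Real.exp (-l)) + ENNReal.ofReal (1 - Real.exp (-l)) * ENNReal.ofReal (1 - H x) := by
        gcongr
    _ = _ := by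
        rw [← ENNReal.ofReal_mul hk0, ← ENNReal.ofReal_add (Real.exp_pos _).le
          (mul_nonneg hk0 (by linarith [h1 x]))]
        congr 1
        ring

lemma Phi_uStep {d : ℕ} (hd : 0 < d) (H : V d → ℝ) (z : V d) (l : ℝ) (hl : 0 ≤ l)
    (h0 : ∀ x, 0 ≤ H x) (h1 : ∀ x, H x ≤ 1) (hsub : ∀ x, x ≠ z → H x ≤ av H x)
    (E : Finset (V d)) (hE : E.Nonempty) (hzE : z ∉ E) :
    ∫⁻ ω, Phi H z l (uStep E ω) ∂μ0 ≤
      Phi H z l E * ENNReal.ofReal (1 - (1 - Real.exp (-l)) * (∑ x ∈ E, H x) / E.card) := by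
  have hk0 : 0 ≤ 1 - Real.exp (-l) := by
    have : Real.exp (-l) ≤ 1 := Real.exp_le_one_iff.2 (by linarith)
    linarith
  have hk1 : 1 - Real.exp (-l) ≤ 1 := by linarith [Real.exp_pos (-l)]
  have hm : ∀ x, Measurable fun v => Phi H z l (addPt E x v) := fun x =>
    (measurable_of_countable (Phi H z l)).comp (measurable_addPt E x)
  have e := lintegral_mix (pick E) (measurable_pick E) (fun x v => Phi H z l (addPt E x v)) hm
  have e' : ∫⁻ ω, Phi H z l (uStep E ω) ∂μ0 =
    ∫⁻ u, ∫⁻ v, Phi H z l (addPt E (pick E u) v) ∂μ0 ∂μ0 := e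
  rw [e']
  refine (lintegral_mono fun u => Phi_addPt hd H z l hl h0 h1 hsub E hzE (pick E u)).trans ?_
  rw [lintegral_pick E hE (fun x => Phi H z l E * ENNReal.ofReal (1 - (1 - Real.exp (-l)) * H x)),
    ← Finset.mul_sum, mul_assoc]
  have hcard : (0 : ℝ) < E.card := by exact_mod_cast Finset.card_pos.2 hE
  have hnn : ∀ x ∈ E, 0 ≤ 1 - (1 - Real.exp (-l)) * H x := by
    intro x _
    have := mul_le_one₀ hk1 (h0 x) (h1 x)
    linarith
  rw [← ENNReal.ofReal_sum_of_nonneg hnn, ← ENNReal.ofReal_natCast, ← ENNReal.ofReal_inv_of_pos hcard,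
    ← ENNReal.ofReal_mul (Finset.sum_nonneg hnn)]
  gcongr
  rw [Finset.sum_sub_distrib, ← Finset.mul_sum, Finset.sum_const, nsmul_eq_mul]
  apply le_of_eq
  field_simp

lemma Phi_subStep {d : ℕ} (hd : 0 < d) (H : V d → ℝ) (z : V d) (l : ℝ) (hl : 0 ≤ l)
    (h0 : ∀ x, 0 ≤ H x) (h1 : ∀ x, H x ≤ 1) (hsub : ∀ x, x ≠ z → H x ≤ av H x)
    (m k : ℕ) (E : Finset (V d)) (hE : E.Nonempty) (hc : E.card ≤ m + k) :
    ∫⁻ ω, Phi H z l (subStep m k E ω) ∂μ0 ≤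
      Phi H z l E * ENNReal.ofReal (1 - (1 - Real.exp (-l)) * (∑ x ∈ E, H x) / (m + k)) := by
  classical
  have hcard : (0 : ℝ) < E.card := by exact_mod_cast Finset.card_pos.2 hE
  have hc' : (E.card : ℝ) ≤ m + k := by exact_mod_cast hc
  have hmk : 0 < (m : ℝ) + k := by linarith
  have hk0 : 0 ≤ 1 - Real.exp (-l) := by
    have : Real.exp (-l) ≤ 1 := Real.exp_le_one_iff.2 (by linarith)
    linarith
  have hk1 : 1 - Real.exp (-l) ≤ 1 := by linarith [Real.exp_pos (-l)]
  by_cases hzE : z ∈ E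
  · have : ∀ ω, Phi H z l (subStep m k E ω) = 0 := by
      intro ω
      unfold Phi
      rw [if_pos]
      unfold subStep uStep addPt
      split_ifs
      · exact Finset.mem_insert_of_mem hzE
      · exact hzE
    simp [this]
  obtain ⟨p, hp⟩ : ∃ p : ℝ, p = E.card / ((m : ℝ) + k) := ⟨_, rfl⟩
  have hp0 : 0 ≤ p := by rw [hp]; positivity
  have hp1 : p ≤ 1 := by rw [hp, div_le_one hmk]; exact hc'
  obtain ⟨c, hcd⟩ : ∃ c : ℝ, c = 1 - (1 - Real.exp (-l)) * (∑ x ∈ E, H x) / E.card := ⟨_, rfl⟩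
  have hc0 : 0 ≤ c := by
    have hS : ∑ x ∈ E, H x ≤ E.card := by
      calc ∑ x ∈ E, H x ≤ ∑ x ∈ E, (1 : ℝ) := Finset.sum_le_sum fun x _ => h1 x
        _ = _ := by simp
    have hS0 : 0 ≤ ∑ x ∈ E, H x := Finset.sum_nonneg fun x _ => h0 x
    have : (1 - Real.exp (-l)) * (∑ x ∈ E, H x) / E.card ≤ 1 := by
      rw [div_le_one hcard]; nlinarith
    rw [hcd]; linarith
  have hm : ∀ b : Bool, Measurable fun v => Phi H z l (if b then uStep E v else E) := by
    intro b
    cases b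
    · simp
    · simp only [if_true]
      exact (measurable_of_countable (Phi H z l)).comp (measurable_uStep E)
  have e := lintegral_mix (fun u => decide (u ≤ p)) (measurable_decide_le p)
    (fun b v => Phi H z l (if b then uStep E v else E)) hm
  simp_rw [subStep_eq m k E hmk, ← hp]
  rw [e]
  have hin : ∀ u : ℝ, ∫⁻ v, Phi H z l (if decide (u ≤ p) = true then uStep E v else E) ∂μ0 ≤
      Set.indicator {u | u ≤ p} (fun _ => Phi H z l E * ENNReal.ofReal c) u +
      Set.indicator {u | u ≤ p}ᶜ (fun _ => Phi H z l E) u := by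
    intro u
    by_cases hu : u ≤ p
    · have h2 := Phi_uStep hd H z l hl h0 h1 hsub E hE hzE
      rw [← hcd] at h2
      simpa [hu, Set.indicator] using h2
    · simp [hu, Set.indicator]
  refine (lintegral_mono hin).trans ?_
  have hms : MeasurableSet {u : ℝ | u ≤ p} := measurableSet_Iic
  rw [lintegral_add_left (measurable_const.indicator hms), lintegral_indicator_const hms,
    lintegral_indicator_const hms.compl, prob_compl_eq_one_sub hms, mu0_threshold p hp0 hp1,
    ← ENNReal.ofReal_one, ← ENNReal.ofReal_sub _ hp0, mul_assoc, ← ENNReal.ofReal_mul hc0, ← mul_add,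
    ← ENNReal.ofReal_add (mul_nonneg hc0 hp0) (by linarith)]
  gcongr
  apply le_of_eq
  rw [hcd, hp]
  field_simp
  ring

lemma prob_bound {d : ℕ} (hd : 0 < d) (H : V d → ℝ) (z : V d) (l : ℝ) (hl : 0 ≤ l)
    (h0 : ∀ x, 0 ≤ H x) (h1 : ∀ x, H x ≤ 1) (hsub : ∀ x, x ≠ z → H x ≤ av H x)
    (B D : Finset (V d)) (hB : B.Nonempty) (M N : ℕ) (hM : B.card ≤ M) (hzB : z ∉ B)
    (hD : ∀ x, x ∉ D → H x = 0) :
    μ0 {ω | z ∉ subAggFrom B M ω N} ≤ ENNReal.ofReal (Real.exp (l * (∑ x ∈ D, H x - ∑ x ∈ B, H x) -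
      (1 - Real.exp (-l)) * (∑ x ∈ B, H x) * (N / (M + N)))) := by
  classical
  have hk0 : 0 ≤ 1 - Real.exp (-l) := by
    have : Real.exp (-l) ≤ 1 := Real.exp_le_one_iff.2 (by linarith)
    linarith
  have hchain : ∀ ω k, subAggFrom B M ω k = chain (fun k E u => subStep M k E u) B ω k := by
    intro ω k
    induction k with
    | zero => rfl
    | succ k ih => rw [subAggFrom, chain, ih]
  obtain ⟨S, hS⟩ : ∃ S, S = ∑ x ∈ B, H x := ⟨_, rfl⟩
  have hS0 : 0 ≤ S := hS ▸ Finset.sum_nonneg fun x _ => h0 x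
  obtain ⟨r, hr⟩ : ∃ r, r = Real.exp (-((1 - Real.exp (-l)) * S / (M + N))) := ⟨_, rfl⟩
  have hr0 : 0 ≤ r := hr ▸ (Real.exp_pos _).le
  have hstep : ∀ k (E : Finset (V d)), Measurable ((fun k E u => subStep M k E u) k E) :=
    fun k E => measurable_subStep M k E
  have hBc := Finset.card_pos.2 hB
  have hsuper := chain_super (fun k E u => subStep M k E u) hstep B N
    (fun k E => B ⊆ E ∧ E.card ≤ M + k) (fun k E => Phi H z l E * ENNReal.ofReal r ^ (N - k))
    ⟨subset_rfl, by omega⟩ ?_ ?_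
  · have hT : ∀ E : Finset (V d), z ∉ E → ENNReal.ofReal (Real.exp (-l * ∑ x ∈ D, H x)) ≤ Phi H z l E := by
      intro E hE
      unfold Phi
      rw [if_neg hE]
      apply ENNReal.ofReal_le_ofReal
      apply Real.exp_le_exp.2
      have : ∑ x ∈ E, H x ≤ ∑ x ∈ D, H x := by
        rw [← Finset.sum_filter_of_ne (p := fun x => x ∈ D) (fun x _ hx => by
          by_contra hc; exact hx (hD x hc))]
        apply Finset.sum_le_sum_of_subset_of_nonneg
        · intro x hx; exact (Finset.mem_filter.1 hx).2
        · intro x _ _; exact h0 x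
      nlinarith
    have hms : MeasurableSet {ω | z ∉ subAggFrom B M ω N} := by
      simp_rw [hchain]
      exact measurable_chain _ hstep B N (MeasurableSet.of_discrete (s := {E | z ∉ E}))
    have hmul : ENNReal.ofReal (Real.exp (-l * ∑ x ∈ D, H x)) * μ0 {ω | z ∉ subAggFrom B M ω N} ≤
        ENNReal.ofReal (Real.exp (-l * S)) * ENNReal.ofReal r ^ N := by
      have hP0 : Phi H z l B = ENNReal.ofReal (Real.exp (-l * S)) := by simp [Phi, hzB, hS]
      simp only [Nat.sub_zero, hP0] at hsuper
      refine le_trans ?_ hsuper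
      rw [← lintegral_indicator_const hms]
      apply lintegral_mono
      intro ω
      simp only [Set.indicator, Set.mem_ofPred_eq, Nat.sub_self, pow_zero, mul_one]
      split_ifs with hω
      · exact zero_le
      · rw [← hchain]; exact hT _ hω
    have h3 : μ0 {ω | z ∉ subAggFrom B M ω N} = ENNReal.ofReal (Real.exp (l * ∑ x ∈ D, H x)) *
        (ENNReal.ofReal (Real.exp (-l * ∑ x ∈ D, H x)) * μ0 {ω | z ∉ subAggFrom B M ω N}) := by
      rw [← mul_assoc, ← ENNReal.ofReal_mul (Real.exp_pos _).le, ← Real.exp_add]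
      simp
    rw [h3]
    calc _ ≤ ENNReal.ofReal (Real.exp (l * ∑ x ∈ D, H x)) *
          (ENNReal.ofReal (Real.exp (-l * S)) * ENNReal.ofReal r ^ N) := by gcongr
      _ = _ := by
        rw [← ENNReal.ofReal_pow hr0, ← ENNReal.ofReal_mul (Real.exp_pos _).le,
          ← ENNReal.ofReal_mul (Real.exp_pos _).le, hr, ← Real.exp_nat_mul, ← Real.exp_add, ← Real.exp_add,
          ← hS]
        congr 2
        ring
  · rintro k E u ⟨hBE, hEc⟩
    simp only [subStep]
    split_ifs
    · unfold uStep addPt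
      refine ⟨hBE.trans (Finset.subset_insert _ _), ?_⟩
      have := Finset.card_insert_le (hitPt E (pick E (uSlice (uSlice u 1) 0)) (uSlice (uSlice u 1) 1)) E
      omega
    · exact ⟨hBE, by omega⟩
  · rintro k hk E ⟨hBE, hEc⟩
    rw [lintegral_mul_const' _ _ (by simp)]
    have h2 := Phi_subStep hd H z l hl h0 h1 hsub M k E (hB.mono hBE) hEc
    have h3 : 1 - (1 - Real.exp (-l)) * (∑ x ∈ E, H x) / (M + k) ≤ r := by
      rw [hr]
      have a1 : (1 - Real.exp (-l)) * S / (M + N) ≤ (1 - Real.exp (-l)) * (∑ x ∈ E, H x) / (M + k) := by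
        have hMp : (0 : ℝ) < M := by exact_mod_cast (by omega : 0 < M)
        have hkN : (k : ℝ) ≤ N := by exact_mod_cast hk.le
        have : S ≤ ∑ x ∈ E, H x := by
          rw [hS]; exact Finset.sum_le_sum_of_subset_of_nonneg hBE fun x _ _ => h0 x
        have hnn := mul_nonneg hk0 (Finset.sum_nonneg (s := E) fun x _ => h0 x)
        gcongr
      have := Real.add_one_le_exp (-((1 - Real.exp (-l)) * S / (M + N)))
      linarith
    calc _ ≤ (Phi H z l E * ENNReal.ofReal r) * ENNReal.ofReal r ^ (N - (k + 1)) := by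
          gcongr
          exact h2.trans (by gcongr)
      _ = _ := by
          rw [mul_assoc, ← pow_succ']
          congr 2
          omega

end Step

/-! ### Parameters -/

lemma le_bn {d : ℕ} (hd : 0 < d) (n : ℕ) : n ≤ bn d n := by
  unfold bn
  have : n = (Finset.range n).card := by simp
  conv_lhs => rw [this]
  refine Finset.card_le_card_of_injOn (fun j : ℕ => (fun i => if i = ⟨0, hd⟩ then (j : ℤ) else 0 : V d)) ?_ ?_
  · intro j hj
    have hj' : j < n := by simpa using hj
    have hjr : (j : ℝ) ≤ n := by exact_mod_cast hj'.le
    change _ ∈ ball d n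
    rw [mem_ball (by positivity)]
    unfold nsq
    have : ∀ i : Fin d, (((if i = ⟨0, hd⟩ then (j : ℤ) else 0 : ℤ) : ℝ)) ^ 2 =
      if i = ⟨0, hd⟩ then (j : ℝ) ^ 2 else 0 := by
      intro i; split_ifs <;> simp
    rw [Finset.sum_congr rfl fun i _ => this i]
    simp only [Finset.sum_ite_eq', Finset.mem_univ, if_true]
    gcongr
  · intro a _ b _ h
    have := congrFun h ⟨0, hd⟩
    simpa using this

lemma exp_kappa {l : ℝ} (hl : 0 ≤ l) : l - l ^ 2 / 2 ≤ 1 - Real.exp (-l) := by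
  have h := Real.quadratic_le_exp_of_nonneg hl
  have h2 : Real.exp (-l) ≤ 1 - l + l ^ 2 / 2 := by
    rw [Real.exp_neg]
    rw [inv_le_comm₀ (Real.exp_pos _) (by nlinarith [sq_nonneg (l - 1)])]
    refine le_trans ?_ h
    rw [inv_le_iff_one_le_mul₀ (by nlinarith [sq_nonneg (l - 1)])]
    nlinarith [sq_nonneg (l ^ 2), sq_nonneg l]
  linarith

lemma exponent_le {q T S e A a B f l : ℝ} (hq : 0 ≤ q) (he : 0 < e) (hA : 0 < A) (ha : 0 ≤ a) (hS : 0 ≤ S)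
    (hST : S ≤ T) (hT : T ≤ q * B) (hB : B ≤ 2 * a) (hgap : q * (A * a ^ 2) ≤ (1 + e) * S - T)
    (hf : e ≤ f) (hl : l = A * a / (2 * e)) :
    l * (T - S) - (1 - Real.exp (-l)) * S * f ≤ - (q * A ^ 2 * a ^ 3 / (4 * e)) := by
  have hl0 : 0 ≤ l := by rw [hl]; positivity
  have hk := exp_kappa hl0
  have hk0 : 0 ≤ 1 - Real.exp (-l) := by
    have : Real.exp (-l) ≤ 1 := Real.exp_le_one_iff.2 (by linarith)
    linarith
  have h1 : (1 - Real.exp (-l)) * S * e ≤ (1 - Real.exp (-l)) * S * f := by gcongr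
  have h2 : (l - l ^ 2 / 2) * (S * e) ≤ (1 - Real.exp (-l)) * (S * e) := by gcongr
  have h3 : l * (q * (A * a ^ 2)) ≤ l * ((1 + e) * S - T) := by gcongr
  have h4 : S ≤ q * (2 * a) := hST.trans (hT.trans (by gcongr))
  have h5 : l ^ 2 / 2 * (S * e) ≤ l ^ 2 / 2 * (q * (2 * a) * e) := by gcongr
  have h6 : - (l * (q * (A * a ^ 2))) + l ^ 2 / 2 * (q * (2 * a) * e) = - (q * A ^ 2 * a ^ 3 / (4 * e)) := by
    rw [hl]; field_simp; ring
  rw [← h6]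
  nlinarith

set_option maxHeartbeats 4000000 in
lemma point {d : ℕ} (hd : 2 ≤ d) (y : ℝ) (hy1 : 8 * d ≤ y) (n M N : ℕ) (hn : y ^ 4 = n)
    (hM : bn d n ≤ M) (hN : M / y ^ 2 - 1 ≤ N) (z : V d) (hz : z ∉ ball d n)
    (hzr : nsq z ≤ (y ^ 4 + y ^ 2 / d - 6 * y) ^ 2) :
    μ0 {ω | z ∉ subAggFrom (ball d n) M ω N} ≤ ENNReal.ofReal (Real.exp (-(y / (512 * Real.log y)))) := by
  have hd2 : (2 : ℝ) ≤ d := by exact_mod_cast hd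
  have hd0 : (0 : ℝ) < d := by linarith
  have hy16 : 16 ≤ y := by linarith
  have hy0 : 0 < y := by linarith
  have hnpos : 0 < n := by
    have : (0 : ℝ) < n := by rw [← hn]; positivity
    exact_mod_cast this
  have hMn : y ^ 4 ≤ M := by
    rw [hn]
    exact_mod_cast (le_bn (by omega) n).trans hM
  -- the parameter e
  obtain ⟨e, he⟩ : ∃ e, e = 1 / y ^ 2 - 2 / y ^ 4 := ⟨_, rfl⟩
  have hey : e * y ^ 4 = y ^ 2 - 2 := by rw [he]; field_simp
  have he2 : e ≤ 1 / y ^ 2 := by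
    have : 0 < 2 / y ^ 4 := by positivity
    linarith
  have hy2 : 256 ≤ y ^ 2 := by nlinarith
  have he1 : e ≤ 1 / 256 := he2.trans (by gcongr)
  have he3 : 1 / (2 * y ^ 2) ≤ e := by
    rw [div_le_iff₀ (by positivity), he]
    have : (1 / y ^ 2 - 2 / y ^ 4) * (2 * y ^ 2) = 2 - 4 / y ^ 2 := by field_simp; ring
    rw [this]
    have : 4 / y ^ 2 ≤ 1 := by rw [div_le_one (by positivity)]; linarith
    linarith
  have he0 : 0 < e := lt_of_lt_of_le (by positivity) he3
  have hef : e ≤ N / (M + N) := by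
    have hMp : (0 : ℝ) < M := lt_of_lt_of_le (by positivity) hMn
    rw [le_div_iff₀ (by positivity)]
    obtain ⟨u, hu⟩ : ∃ u, u = 1 / y ^ 2 := ⟨_, rfl⟩
    have hu0 : 0 < u := by rw [hu]; positivity
    have hu1 : u ≤ 1 / 256 := by rw [hu]; gcongr
    have heu : e = u - 2 * u ^ 2 := by rw [he, hu]; field_simp
    have hMu : 1 ≤ M * u ^ 2 := by
      have : (M : ℝ) * u ^ 2 = M / y ^ 4 := by rw [hu]; field_simp
      rw [this, le_div_iff₀ (by positivity)]; linarith
    have hN' : M * u - 1 ≤ N := by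
      have : (M : ℝ) / y ^ 2 = M * u := by rw [hu]; field_simp
      linarith
    have h1 : (1 - u) * (M * u - 1) ≤ (1 - e) * N := by
      have hN0 : (0 : ℝ) ≤ N := by positivity
      have a1 : (1 - u) * (M * u - 1) ≤ (1 - u) * N := mul_le_mul_of_nonneg_left hN' (by linarith)
      have a2 : (1 - u) * N ≤ (1 - e) * N := by
        apply mul_le_mul_of_nonneg_right _ hN0
        rw [heu]; nlinarith
      linarith
    rw [heu] at *
    nlinarith
  -- A, R
  obtain ⟨A, hA⟩ : ∃ A, A = d * (1 + e) / (4 * (n : ℝ) ^ 2) := ⟨_, rfl⟩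
  have hA' : A = d * (1 + e) / (4 * y ^ 8) := by rw [hA, ← hn]; ring
  have hA0 : 0 < A := by rw [hA']; positivity
  have hAge : 1 / (2 * y ^ 8) ≤ A := by
    rw [hA', div_le_div_iff₀ (by positivity) (by positivity)]
    have : 0 < y ^ 8 := by positivity
    nlinarith [mul_pos hd0 he0]
  obtain ⟨g, hg⟩ : ∃ g, g = e / (2 * A) := ⟨_, rfl⟩
  have hgv : g = 2 * y ^ 8 / d * (e / (1 + e)) := by
    rw [hg, hA']; field_simp; ring
  have hglow : 2 * y ^ 6 / d - 3 * y ^ 4 ≤ g := by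
    have h1 : e - e ^ 2 ≤ e / (1 + e) := by
      rw [le_div_iff₀ (by linarith)]
      have : 0 ≤ e ^ 3 := by positivity
      nlinarith
    have h2 : 1 / y ^ 2 - 3 / y ^ 4 ≤ e - e ^ 2 := by
      have : e ^ 2 ≤ (1 / y ^ 2) ^ 2 := by gcongr
      have h3 : (1 / y ^ 2) ^ 2 = 1 / y ^ 4 := by field_simp
      rw [h3] at this
      have h4 : 3 / y ^ 4 = 2 / y ^ 4 + 1 / y ^ 4 := by ring
      linarith
    have h3 : 2 * y ^ 8 / d * (1 / y ^ 2 - 3 / y ^ 4) ≤ g := by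
      rw [hgv]
      have := h2.trans h1
      gcongr
    refine le_trans ?_ h3
    have h4 : 2 * y ^ 8 / d * (1 / y ^ 2 - 3 / y ^ 4) = 2 * y ^ 6 / d - 6 * y ^ 4 / d := by
      field_simp
      ring
    rw [h4]
    have : 6 * y ^ 4 / d ≤ 3 * y ^ 4 := by
      rw [div_le_iff₀ hd0]
      nlinarith [pow_pos hy0 4]
    linarith
  have hghigh : g ≤ y ^ 6 := by
    have h1 : e / (1 + e) ≤ 1 / y ^ 2 := by
      refine le_trans ?_ he2
      rw [div_le_iff₀ (by linarith)]; nlinarith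
    have h2 : g ≤ 2 * y ^ 8 / d * (1 / y ^ 2) := by rw [hgv]; gcongr
    have h3 : 2 * y ^ 8 / d * (1 / y ^ 2) = 2 * y ^ 6 / d := by field_simp
    rw [h3] at h2
    refine h2.trans ?_
    rw [div_le_iff₀ hd0]
    nlinarith [pow_pos hy0 6]
  obtain ⟨s, hs⟩ : ∃ s, s = Real.sqrt ((y ^ 4 - 1) ^ 2 + g) := ⟨_, rfl⟩
  have hg0 : 0 < g := by rw [hg]; positivity
  have hs0 : 0 ≤ s := hs ▸ Real.sqrt_nonneg _
  have hs2 : s ^ 2 = (y ^ 4 - 1) ^ 2 + g := by rw [hs, Real.sq_sqrt (by positivity)]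
  have hy4 : 65536 ≤ y ^ 4 := by nlinarith
  have hsle : s ≤ 2 * y ^ 4 := by
    apply abs_le_of_sq_le_sq' _ (by positivity) |>.2
    rw [hs2]
    have : y ^ 6 ≤ y ^ 8 := pow_le_pow_right₀ (by linarith) (by norm_num)
    nlinarith
  have hd8 : y ^ 2 / d ≥ 8 * y := by
    rw [ge_iff_le, le_div_iff₀ hd0]; nlinarith
  have hy6 : 2 * y ^ 6 / d ≥ 16 * y ^ 5 := by
    have : 2 * y ^ 6 / d = 2 * y ^ 4 * (y ^ 2 / d) := by ring
    rw [this]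
    have : 2 * y ^ 4 * (y ^ 2 / d) ≥ 2 * y ^ 4 * (8 * y) := by gcongr
    nlinarith
  have hy5 : y ^ 5 ≥ 16 * y ^ 4 := by nlinarith [pow_pos hy0 4]
  have hsge : y ^ 4 + 1 ≤ s := by
    apply (abs_le_of_sq_le_sq' _ hs0).2
    rw [hs2]
    nlinarith
  obtain ⟨R, hR⟩ : ∃ R, R = s - 1 := ⟨_, rfl⟩
  have hnR : (n : ℝ) ≤ R := by rw [← hn, hR]; linarith
  have hR1 : (R + 1) ^ 2 = ((n : ℝ) - 1) ^ 2 + e / (2 * A) := by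
    rw [hR, sub_add_cancel, hs2, hn, hg]
  obtain ⟨a, ha⟩ : ∃ a, a = R ^ 2 - nsq z := ⟨_, rfl⟩
  have hrr : (y ^ 4 + y ^ 2 / d - 6 * y) ^ 2 ≤ y ^ 8 + 2 * y ^ 6 / d - 12 * y ^ 5 + y ^ 4 := by
    have h1 : y ^ 2 / d ≤ y ^ 2 := by
      rw [div_le_iff₀ hd0]; nlinarith
    have h2 : (y ^ 2 / d - 6 * y) ^ 2 ≤ (y ^ 2) ^ 2 := by
      apply pow_le_pow_left₀ <;> linarith
    have h3 : (y ^ 4 + y ^ 2 / d - 6 * y) ^ 2 = y ^ 8 + 2 * y ^ 6 / d - 12 * y ^ 5 + (y ^ 2 / d - 6 * y) ^ 2 := by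
      field_simp; ring
    rw [h3]; linarith
  have hR2 : y ^ 8 + 2 * y ^ 6 / d - 9 * y ^ 4 ≤ R ^ 2 := by
    have : R ^ 2 = s ^ 2 - 2 * s + 1 := by rw [hR]; ring
    rw [this, hs2]
    nlinarith
  have ha1 : 12 * y ^ 5 - 10 * y ^ 4 ≤ a := by rw [ha]; linarith
  have ha5 : y ^ 5 ≤ a := by linarith [pow_pos hy0 4]
  have ha0 : 0 ≤ a := le_trans (by positivity) ha5
  have haR : 2 * R + 1 ≤ a := by rw [hR]; linarith
  have hzR : nsq z ≤ R ^ 2 := by linarith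
  -- the logarithm
  have hlogy : 0 < Real.log y := Real.log_pos (by linarith)
  have hL : Real.log (1 + (2 * (R + 1) ^ 2 + 2 * R ^ 2)) ≤ 16 * Real.log y := by
    have : 16 * Real.log y = Real.log (y ^ 16) := by rw [Real.log_pow]; norm_num
    rw [this]
    apply Real.log_le_log (by positivity)
    have h1 : (R + 1) ^ 2 ≤ 4 * y ^ 8 := by
      have : (R + 1) ^ 2 ≤ (2 * y ^ 4) ^ 2 := by
        apply pow_le_pow_left₀ <;> linarith
      refine this.trans (le_of_eq ?_)
      ring
    have hRpos : 0 ≤ R := le_trans (by positivity) hnR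
    have h2 : R ^ 2 ≤ (R + 1) ^ 2 := by apply pow_le_pow_left₀ <;> linarith
    have h3 : y ^ 16 = y ^ 8 * (y ^ 4 * y ^ 4) := by ring
    have h4 : 65536 * 65536 ≤ y ^ 4 * y ^ 4 := by gcongr
    have h5 : y ^ 8 = y ^ 4 * y ^ 4 := by ring
    have h6 : y ^ 8 * (65536 * 65536) ≤ y ^ 8 * (y ^ 4 * y ^ 4) := by gcongr
    have h7 : 1 ≤ y ^ 8 := by rw [h5]; linarith
    rw [h3]
    linarith
  obtain ⟨H, q, T, S, h0, h1, hz1, hoff, hsub, hq, hT, hS, hST, hTq, hgap⟩ :=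
    potential hd n hnpos e A R (16 * Real.log y) he0 hA hnR hR1 z hz hzR hL
  have hq0 : 0 ≤ q := le_trans (div_nonneg (Real.log_nonneg (by norm_num)) (by positivity)) hq
  have hS0 : 0 ≤ S := by rw [hS]; exact Finset.sum_nonneg fun x _ => h0 x
  rw [← ha] at hgap
  have hB : (R + 1) ^ 2 - nsq z ≤ 2 * a := by
    have : (R + 1) ^ 2 - nsq z = a + (2 * R + 1) := by rw [ha]; ring
    linarith
  have hexp := exponent_le hq0 he0 hA0 ha0 hS0 hST hTq hB hgap hef rfl
  have hBne : (ball d (n : ℝ)).Nonempty := ⟨0, by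
    rw [mem_ball (by positivity)]; simp [nsq]⟩
  have hprob := prob_bound (by omega) H z (A * a / (2 * e)) (by positivity) h0 h1 hsub (ball d n) (ball d R)
    hBne M N hM hz hoff
  rw [← hT, ← hS] at hprob
  refine hprob.trans (ENNReal.ofReal_le_ofReal (Real.exp_le_exp.2 (hexp.trans ?_)))
  apply neg_le_neg
  have hq' : 1 / (32 * Real.log y) ≤ q := by
    refine le_trans ?_ hq
    rw [div_le_div_iff₀ (by positivity) (by positivity)]
    have h2 : (1 / 2 : ℝ) ≤ Real.log 2 := by linarith only [Real.log_two_gt_d9]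
    have h3 := mul_le_mul_of_nonneg_right h2 (by positivity : 0 ≤ 32 * Real.log y)
    linarith only [h3]
  calc y / (512 * Real.log y) = 1 / (32 * Real.log y) * (1 / (2 * y ^ 8)) ^ 2 * (y ^ 5) ^ 3 / (4 * (1 / y ^ 2)) := by
        field_simp; norm_num
    _ ≤ q * A ^ 2 * a ^ 3 / (4 * e) := by gcongr

lemma subset_subAgg {d : ℕ} (E : Finset (V d)) (m : ℕ) (ω : ℝ) (k : ℕ) : E ⊆ subAggFrom E m ω k := by
  induction k with
  | zero => exact subset_rfl
  | succ k ih =>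
    rw [subAggFrom]
    unfold subStep uStep addPt
    split_ifs
    · exact ih.trans (Finset.subset_insert _ _)
    · exact ih

lemma card_ball_le {d : ℕ} {r b : ℝ} (hr : 0 ≤ r) (hb : 2 * r + 3 ≤ b) :
    ((ball d r).card : ℝ) ≤ b ^ d := by
  have h1 : (ball d r).card ≤ (Finset.Icc (fun _ => -⌈r⌉ : V d) (fun _ => ⌈r⌉)).card := by
    unfold ball
    exact Finset.card_filter_le _ _
  have h2 : (Finset.Icc (fun _ => -⌈r⌉ : V d) (fun _ => ⌈r⌉)).card = ((⌈r⌉ + 1 - -⌈r⌉).toNat) ^ d := by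
    rw [Pi.card_Icc]
    simp
  rw [h2] at h1
  have h3 : ((ball d r).card : ℝ) ≤ (((⌈r⌉ + 1 - -⌈r⌉).toNat ^ d : ℕ) : ℝ) := by exact_mod_cast h1
  refine h3.trans ?_
  push_cast
  gcongr
  have h4 : 0 ≤ ⌈r⌉ := Int.ceil_nonneg hr
  have h5 : (((⌈r⌉ + 1 - -⌈r⌉).toNat : ℕ) : ℝ) = ((⌈r⌉ + 1 - -⌈r⌉ : ℤ) : ℝ) := by
    have : (((⌈r⌉ + 1 - -⌈r⌉).toNat : ℕ) : ℤ) = ⌈r⌉ + 1 - -⌈r⌉ := Int.toNat_of_nonneg (by omega)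
    exact_mod_cast congrArg (fun k : ℤ => (k : ℝ)) this
  rw [h5]
  push_cast
  have := Int.ceil_lt_add_one r
  linarith

lemma eventually_y (d : ℕ) : ∃ Y : ℝ, 16 ≤ Y ∧ ∀ y : ℝ, Y ≤ y → 8 * d ≤ y ∧
    5 * d * Real.log y - y / (512 * Real.log y) ≤ - Real.sqrt y := by
  have h1 := (isLittleO_log_rpow_atTop (by norm_num : (0 : ℝ) < 1 / 4)).bound (by norm_num : (0 : ℝ) < 1)
  have h2 := (tendsto_rpow_atTop (by norm_num : (0 : ℝ) < 1 / 4)).eventually_ge_atTop (512 * (5 * d + 1))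
  have h3 := h1.and (h2.and (eventually_ge_atTop (max 16 (8 * (d : ℝ)))))
  obtain ⟨Y, hY⟩ := eventually_atTop.1 h3
  refine ⟨max Y 16, le_max_right _ _, fun y hy => ?_⟩
  obtain ⟨a1, a2, a3⟩ := hY y ((le_max_left _ _).trans hy)
  have hy16 : 16 ≤ y := (le_max_right _ _).trans hy
  refine ⟨(le_max_right _ _).trans a3, ?_⟩
  have hlog : 0 < Real.log y := Real.log_pos (by linarith)
  obtain ⟨t, ht⟩ : ∃ t, t = y ^ (1 / 4 : ℝ) := ⟨_, rfl⟩
  have ht0 : 0 < t := by rw [ht]; positivity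
  have ht4 : t ^ 4 = y := by
    rw [ht, ← Real.rpow_natCast, ← Real.rpow_mul (by linarith)]; norm_num
  rw [← ht] at a1 a2
  rw [one_mul, Real.norm_of_nonneg hlog.le, Real.norm_of_nonneg ht0.le] at a1
  have hsq : Real.sqrt y = t ^ 2 := by
    rw [← ht4, show t ^ 4 = (t ^ 2) ^ 2 by ring, Real.sqrt_sq (by positivity)]
  rw [hsq]
  have hd0 : (0 : ℝ) ≤ d := by positivity
  have ht1 : 1 ≤ t := by nlinarith
  have key : 5 * d * Real.log y + t ^ 2 ≤ y / (512 * Real.log y) := by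
    rw [le_div_iff₀ (by positivity)]
    calc (5 * d * Real.log y + t ^ 2) * (512 * Real.log y) ≤ (5 * d * t ^ 2 + t ^ 2) * (512 * t) := by
          have : Real.log y ≤ t ^ 2 := a1.trans (by nlinarith)
          gcongr
      _ = t ^ 3 * (512 * (5 * d + 1)) := by ring
      _ ≤ t ^ 3 * t := by gcongr
      _ = y := by rw [← ht4]; ring
  linarith

theorem main8 (d : ℕ) (hd : 2 ≤ d) :
    ∃ δ₂ C₃ C : ℝ, 0 < δ₂ ∧ 0 < C₃ ∧ 0 < C ∧
      ∀ n : ℕ, 1 ≤ n → ∀ M : ℕ, bn d n ≤ M →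
        1 - ENNReal.ofReal (C * Real.exp (-(n : ℝ) ^ δ₂)) ≤
          μ0 {ω |
            ball d ((n : ℝ) *
                (1 + (n : ℝ) ^ (-(1/2 : ℝ)) - C₃ * (n : ℝ) ^ (-(3/4 : ℝ))) ^ ((1 : ℝ)/d)) ⊆
              subAggFrom (ball d n) M ω ⌊(M : ℝ) * (n : ℝ) ^ (-(1/2 : ℝ))⌋₊} := by
  obtain ⟨Y, hY16, hY⟩ := eventually_y d
  have hd2 : (2 : ℝ) ≤ d := by exact_mod_cast hd
  refine ⟨1 / 8, 6 * d, Real.exp (Real.sqrt Y), by norm_num, by positivity, Real.exp_pos _, ?_⟩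
  intro n hn M hM
  have hn1 : (1 : ℝ) ≤ n := by exact_mod_cast hn
  obtain ⟨y, hy⟩ : ∃ y, y = (n : ℝ) ^ (1 / 4 : ℝ) := ⟨_, rfl⟩
  have hy0 : 0 < y := by rw [hy]; positivity
  have hy4 : y ^ 4 = n := by
    rw [hy, ← Real.rpow_natCast, ← Real.rpow_mul (by linarith)]; norm_num
  have hpow8 : (n : ℝ) ^ (1 / 8 : ℝ) = Real.sqrt y := by
    rw [Real.sqrt_eq_rpow, hy, ← Real.rpow_mul (by linarith)]; norm_num
  rw [← Real.exp_add, hpow8]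
  by_cases hyY : Y ≤ y
  swap
  · have : 1 ≤ Real.exp (Real.sqrt Y + -Real.sqrt y) := by
      apply Real.one_le_exp
      have := Real.sqrt_le_sqrt (not_le.1 hyY).le
      linarith
    rw [tsub_eq_zero_of_le]
    · exact zero_le
    · rw [← ENNReal.ofReal_one]; exact ENNReal.ofReal_le_ofReal this
  obtain ⟨hy8, hyexp⟩ := hY y hyY
  have hy16 : 16 ≤ y := hY16.trans hyY
  have hp2 : (n : ℝ) ^ (-(1/2 : ℝ)) = 1 / y ^ 2 := by
    rw [← hy4, ← Real.rpow_natCast y 4, ← Real.rpow_mul hy0.le,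
      show ((4 : ℕ) : ℝ) * (-(1/2)) = -((2 : ℕ) : ℝ) by norm_num, Real.rpow_neg hy0.le,
      Real.rpow_natCast, one_div (y ^ 2)]
  have hp3 : (n : ℝ) ^ (-(3/4 : ℝ)) = 1 / y ^ 3 := by
    rw [← hy4, ← Real.rpow_natCast y 4, ← Real.rpow_mul hy0.le,
      show ((4 : ℕ) : ℝ) * (-(3/4)) = -((3 : ℕ) : ℝ) by norm_num, Real.rpow_neg hy0.le,
      Real.rpow_natCast, one_div (y ^ 3)]
  rw [hp2, hp3]
  obtain ⟨r, hr⟩ : ∃ r, r = (n : ℝ) * (1 + 1 / y ^ 2 - 6 * d * (1 / y ^ 3)) ^ ((1 : ℝ) / d) := ⟨_, rfl⟩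
  obtain ⟨N, hN⟩ : ∃ N, N = ⌊(M : ℝ) * (1 / y ^ 2)⌋₊ := ⟨_, rfl⟩
  rw [← hr, ← hN]
  have hs : 0 ≤ 1 / y ^ 2 - 6 * d * (1 / y ^ 3) := by
    have : 1 / y ^ 2 - 6 * d * (1 / y ^ 3) = (y - 6 * d) / y ^ 3 := by field_simp
    rw [this]
    apply div_nonneg _ (by positivity)
    linarith
  have hr0 : 0 ≤ r := by
    rw [hr]
    have : 0 ≤ 1 + 1 / y ^ 2 - 6 * d * (1 / y ^ 3) := by linarith
    positivity
  have hrle : r ≤ y ^ 4 + y ^ 2 / d - 6 * y := by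
    have h := rpow_one_add_le_one_add_mul_self (s := 1 / y ^ 2 - 6 * d * (1 / y ^ 3)) (by linarith)
      (p := 1 / d) (by positivity) (by rw [div_le_one (by linarith)]; linarith)
    rw [hr, ← hy4, add_sub_assoc]
    calc _ ≤ y ^ 4 * (1 + 1 / d * (1 / y ^ 2 - 6 * d * (1 / y ^ 3))) := by gcongr
      _ = _ := by field_simp; ring
  have hNle : M / y ^ 2 - 1 ≤ N := by
    have := Nat.lt_floor_add_one ((M : ℝ) * (1 / y ^ 2))
    rw [← hN] at this
    rw [mul_one_div] at this
    linarith
  have hcard : ((ball d r).card : ℝ) ≤ (y ^ 5) ^ d := by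
    apply card_ball_le hr0
    have h1 : y ^ 2 / d ≤ y ^ 2 := by
      rw [div_le_iff₀ (by linarith)]; nlinarith
    have h2 : y ^ 2 ≤ y ^ 4 := pow_le_pow_right₀ (by linarith) (by norm_num)
    have h3 : 16 * y ^ 4 ≤ y ^ 5 := by nlinarith [pow_pos hy0 4]
    have h4 : 1 ≤ y ^ 4 := one_le_pow₀ (by linarith)
    linarith
  have hbad : μ0 {ω | ball d r ⊆ subAggFrom (ball d n) M ω N}ᶜ ≤
      ENNReal.ofReal (Real.exp (Real.sqrt Y + -Real.sqrt y)) := by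
    classical
    calc μ0 {ω | ball d r ⊆ subAggFrom (ball d n) M ω N}ᶜ
        ≤ μ0 (⋃ z ∈ ball d r \ ball d n, {ω | z ∉ subAggFrom (ball d n) M ω N}) := by
          apply measure_mono
          intro ω hω
          simp only [Set.mem_compl_iff, Set.mem_ofPred_eq, Finset.not_subset] at hω
          obtain ⟨z, hz1, hz2⟩ := hω
          simp only [Set.mem_iUnion]
          exact ⟨z, Finset.mem_sdiff.2 ⟨hz1, fun h => hz2 (subset_subAgg _ _ _ _ h)⟩, hz2⟩
      _ ≤ ∑ z ∈ ball d r \ ball d n, μ0 {ω | z ∉ subAggFrom (ball d n) M ω N} :=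
          measure_biUnion_finset_le _ _
      _ ≤ ∑ z ∈ ball d r \ ball d n, ENNReal.ofReal (Real.exp (-(y / (512 * Real.log y)))) := by
          apply Finset.sum_le_sum
          intro z hz
          rw [Finset.mem_sdiff] at hz
          apply point hd y hy8 n M N hy4 hM hNle z hz.2
          have := (mem_ball hr0 z).1 hz.1
          refine this.trans ?_
          gcongr
      _ ≤ ∑ z ∈ ball d r, ENNReal.ofReal (Real.exp (-(y / (512 * Real.log y)))) :=
          Finset.sum_le_sum_of_subset Finset.sdiff_subset
      _ = ENNReal.ofReal ((ball d r).card * Real.exp (-(y / (512 * Real.log y)))) := by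
          rw [Finset.sum_const, nsmul_eq_mul, ENNReal.ofReal_mul (by positivity), ENNReal.ofReal_natCast]
      _ ≤ _ := by
          apply ENNReal.ofReal_le_ofReal
          have h5 : (y ^ 5) ^ d = Real.exp (5 * d * Real.log y) := by
            rw [← pow_mul, ← Real.exp_log (pow_pos hy0 (5 * d)), Real.log_pow]
            push_cast
            rfl
          calc _ ≤ (y ^ 5) ^ d * Real.exp (-(y / (512 * Real.log y))) := by gcongr
            _ = Real.exp (5 * d * Real.log y - y / (512 * Real.log y)) := by
              rw [h5, ← Real.exp_add, sub_eq_add_neg]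
            _ ≤ _ := by
              apply Real.exp_le_exp.2
              have := Real.sqrt_nonneg Y
              linarith
  rw [tsub_le_iff_right]
  calc (1 : ℝ≥0∞) = μ0 Set.univ := measure_univ.symm
    _ = μ0 ({ω | ball d r ⊆ subAggFrom (ball d n) M ω N} ∪ {ω | ball d r ⊆ subAggFrom (ball d n) M ω N}ᶜ) := by
        rw [Set.union_compl_self]
    _ ≤ _ := (measure_union_le _ _).trans (by gcongr)

theorem statement8 (d : ℕ) (hd : 2 ≤ d) :
    ∃ δ₂ C₃ C : ℝ, 0 < δ₂ ∧ 0 < C₃ ∧ 0 < C ∧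
      ∀ n : ℕ, 1 ≤ n → ∀ M : ℕ, bn d n ≤ M →
        1 - ENNReal.ofReal (C * Real.exp (-(n : ℝ) ^ δ₂)) ≤
          μ0 {ω |
            ball d ((n : ℝ) *
                (1 + (n : ℝ) ^ (-(1/2 : ℝ)) - C₃ * (n : ℝ) ^ (-(3/4 : ℝ))) ^ ((1 : ℝ)/d)) ⊆
              subAggFrom (ball d n) M ω ⌊(M : ℝ) * (n : ℝ) ^ (-(1/2 : ℝ))⌋₊} := by
  exact main8 d hd
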